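/- arXiv:2203.11627 — 4 statements merged into one kernel-verified Lean document; each statement's English description precedes it below -/
import Mathlib

section
/- Let μ and ν be Borel probability measures on ℝ^d with finite second moments. For m, n ∈ ℕ, let X₁,…,Xₘ be random vectors each distributed according to μ and Y₁,…,Yₙ be random vectors each distributed according to ν, with arbitrary joint dependence among all the samples. Let μ̂ₘ = m⁻¹ Σᵢ δ_{Xᵢ} and ν̂ₙ = n⁻¹ Σⱼ δ_{Yⱼ}. Then E[W₂²(μ̂ₘ, ν̂ₙ)] ≥ W₂²(μ, ν). -/
open MeasureTheory ProbabilityTheory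

noncomputable section

/-- `ℝ^d` with the Euclidean norm. -/
abbrev Euc (d : ℕ) := EuclideanSpace ℝ (Fin d)

/-- The squared 2-Wasserstein distance: the infimum of `∫ ‖x - y‖²` over all couplings. -/
def W2sq {d : ℕ} (μ ν : Measure (Euc d)) : ℝ :=
  (⨅ π ∈ {π : Measure (Euc d × Euc d) |
      IsProbabilityMeasure π ∧ π.map Prod.fst = μ ∧ π.map Prod.snd = ν},
    ∫⁻ p, (‖p.1 - p.2‖₊ : ENNReal) ^ 2 ∂π).toReal

/-- Empirical measure `n⁻¹ ∑ᵢ δ_{X i ω}` of a finite sample. -/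
def empMeas {d n : ℕ} {Ω : Type*} (X : Fin n → Ω → Euc d) (ω : Ω) : Measure (Euc d) :=
  (n : ENNReal)⁻¹ • ∑ i : Fin n, Measure.dirac (X i ω)

/-- The extended-real valued squared Wasserstein distance. -/
def VV {d : ℕ} (μ ν : Measure (Euc d)) : ENNReal :=
  ⨅ π ∈ {π : Measure (Euc d × Euc d) |
      IsProbabilityMeasure π ∧ π.map Prod.fst = μ ∧ π.map Prod.snd = ν},
    ∫⁻ p, (‖p.1 - p.2‖₊ : ENNReal) ^ 2 ∂π

/-- Transport matrices with uniform marginals. -/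
def TM (m n : ℕ) : Set (Fin m → Fin n → NNReal) :=
  {A | (∀ i, ∑ j, A i j = (m : NNReal)⁻¹) ∧ (∀ j, ∑ i, A i j = (n : NNReal)⁻¹)}

/-- Cost of a transport matrix. -/
def cst {d m n : ℕ} (A : Fin m → Fin n → NNReal) (x : Fin m → Euc d) (y : Fin n → Euc d) :
    NNReal := ∑ i, ∑ j, A i j * ‖x i - y j‖₊ ^ 2

lemma meas_cost {d : ℕ} :
    Measurable (fun p : Euc d × Euc d => (‖p.1 - p.2‖₊ : ENNReal) ^ 2) := by
  fun_prop

lemma VV_le {d m n : ℕ} (hm : 0 < m) {Ω : Type*} [MeasurableSpace Ω] (P : Measure Ω)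
    [IsProbabilityMeasure P] (X : Fin m → Ω → Euc d) (Y : Fin n → Ω → Euc d)
    (hX : ∀ i, Measurable (X i)) (hY : ∀ j, Measurable (Y j))
    (a : Fin m → Fin n → Ω → ENNReal) (ha : ∀ i j, Measurable (a i j))
    (hr : ∀ i ω, ∑ j, a i j ω = (m : ENNReal)⁻¹) (hc : ∀ j ω, ∑ i, a i j ω = (n : ENNReal)⁻¹) :
    VV ((m : ENNReal)⁻¹ • ∑ i, P.map (X i)) ((n : ENNReal)⁻¹ • ∑ j, P.map (Y j)) ≤
      ∫⁻ ω, ∑ i, ∑ j, a i j ω * (‖X i ω - Y j ω‖₊ : ENNReal) ^ 2 ∂P := by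
  have hXY : ∀ i j, Measurable (fun ω => (X i ω, Y j ω)) := fun i j => (hX i).prodMk (hY j)
  let π : Measure (Euc d × Euc d) :=
    ∑ i, ∑ j, (P.withDensity (a i j)).map (fun ω => (X i ω, Y j ω))
  have hπ : ∀ f : Euc d × Euc d → ENNReal, Measurable f →
      ∫⁻ p, f p ∂π = ∫⁻ ω, ∑ i, ∑ j, a i j ω * f (X i ω, Y j ω) ∂P := by
    intro f hf
    simp only [π]
    rw [lintegral_finsetSum_measure, lintegral_finsetSum]
    · refine Finset.sum_congr rfl fun i _ => ?_
      rw [lintegral_finsetSum_measure, lintegral_finsetSum]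
      · refine Finset.sum_congr rfl fun j _ => ?_
        rw [lintegral_map hf (hXY i j)]
        exact lintegral_withDensity_eq_lintegral_mul _ (ha i j) (hf.comp (hXY i j))
      · intro j _
        exact (ha i j).mul (hf.comp (hXY i j))
    · intro i _
      exact Finset.measurable_sum _ fun j _ => (ha i j).mul (hf.comp (hXY i j))
  have h1 : π.map Prod.fst = (m : ENNReal)⁻¹ • ∑ i, P.map (X i) := by
    refine Measure.ext_of_lintegral _ fun f hf => ?_
    rw [lintegral_map hf measurable_fst, hπ (fun p => f p.1) (hf.comp measurable_fst), lintegral_smul_measure,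
      lintegral_finsetSum_measure]
    simp only [← Finset.sum_mul, hr, smul_eq_mul]
    rw [lintegral_finsetSum _ (fun i _ => Measurable.const_mul (f := fun ω => f (X i ω)) (hf.comp (hX i)) _), Finset.mul_sum]
    refine Finset.sum_congr rfl fun i _ => ?_
    rw [lintegral_map hf (hX i)]
    exact lintegral_const_mul _ (hf.comp (hX i))
  have h2 : π.map Prod.snd = (n : ENNReal)⁻¹ • ∑ j, P.map (Y j) := by
    refine Measure.ext_of_lintegral _ fun f hf => ?_
    rw [lintegral_map hf measurable_snd, hπ (fun p => f p.2) (hf.comp measurable_snd), lintegral_smul_measure,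
      lintegral_finsetSum_measure]
    have : ∀ ω, ∑ i, ∑ j, a i j ω * f (Y j ω) = ∑ j, (n : ENNReal)⁻¹ * f (Y j ω) := by
      intro ω
      rw [Finset.sum_comm]
      simp only [← Finset.sum_mul, hc]
    simp only [this, smul_eq_mul]
    rw [lintegral_finsetSum _ (fun i _ => Measurable.const_mul (f := fun ω => f (Y i ω)) (hf.comp (hY i)) _), Finset.mul_sum]
    refine Finset.sum_congr rfl fun i _ => ?_
    rw [lintegral_map hf (hY i)]
    exact lintegral_const_mul _ (hf.comp (hY i))
  have hp : IsProbabilityMeasure π := by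
    constructor
    have h := hπ (fun _ => 1) measurable_const
    simp only [lintegral_const, one_mul, mul_one, hr] at h
    rw [h]
    simp
    exact ENNReal.mul_inv_cancel (by exact_mod_cast hm.ne') (by simp)
  calc _ ≤ ∫⁻ p, (‖p.1 - p.2‖₊ : ENNReal) ^ 2 ∂π := iInf₂_le π ⟨hp, h1, h2⟩
    _ = _ := hπ _ meas_cost

/-- Normalised indicator. -/
def phi {d m : ℕ} (x : Fin m → Euc d) (i : Fin m) (u : Euc d) : ENNReal :=
  open Classical in
  if u = x i then ((Finset.univ.filter fun k => x k = u).card : ENNReal)⁻¹ else 0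

lemma phi_meas {d m : ℕ} (x : Fin m → Euc d) (i : Fin m) : Measurable (phi x i) := by
  classical
  have : phi x i = ({x i} : Set (Euc d)).indicator
      (fun _ => ((Finset.univ.filter fun k => x k = x i).card : ENNReal)⁻¹) := by
    ext u
    by_cases h : u = x i
    · subst h; simp [phi]
    · simp [phi, h]
  rw [this]
  exact measurable_const.indicator (measurableSet_singleton _)

lemma phi_sum {d m : ℕ} (x : Fin m → Euc d) (k : Fin m) : ∑ i, phi x i (x k) = 1 := by
  classical
  simp only [phi]
  rw [← Finset.sum_filter, Finset.sum_const, nsmul_eq_mul]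
  have : (Finset.univ.filter fun i => x k = x i) = Finset.univ.filter fun i => x i = x k := by
    ext i; simp [eq_comm]
  rw [this]
  refine ENNReal.mul_inv_cancel ?_ (by simp)
  have : k ∈ Finset.univ.filter fun i => x i = x k := by simp
  exact_mod_cast (Finset.card_pos.2 ⟨k, this⟩).ne'

lemma phi_sum' {d m : ℕ} (x : Fin m → Euc d) (i : Fin m) : ∑ k, phi x i (x k) = 1 := by
  classical
  have : ∀ k, phi x i (x k) = phi x k (x i) := by
    intro k
    by_cases h : x k = x i
    · simp [phi, h]
    · have h' : ¬ x i = x k := fun e => h e.symm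
      simp [phi, h, h']
  simp only [this, phi_sum]

/-- Empirical measure of points. -/
def emp {d m : ℕ} (x : Fin m → Euc d) : Measure (Euc d) :=
  (m : ENNReal)⁻¹ • ∑ i : Fin m, Measure.dirac (x i)

lemma phi_ae {d m : ℕ} (x : Fin m → Euc d) : ∀ᵐ u ∂(emp x), ∑ i, phi x i u = 1 := by
  have hms : MeasurableSet {u | ∑ i, phi x i u = 1} :=
    (Finset.measurable_sum _ fun i _ => phi_meas x i) (measurableSet_singleton 1)
  rw [ae_iff]
  have : {u | ¬ ∑ i, phi x i u = 1} = {u | ∑ i, phi x i u = 1}ᶜ := rfl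
  rw [this]
  simp only [emp, Measure.smul_apply, Measure.finsetSum_apply, Measure.dirac_apply' _ hms.compl]
  simp [phi_sum]

lemma phi_int {d m : ℕ} (x : Fin m → Euc d) (i : Fin m) :
    ∫⁻ u, phi x i u ∂(emp x) = (m : ENNReal)⁻¹ := by
  rw [emp, lintegral_smul_measure, lintegral_finsetSum_measure]
  simp only [lintegral_dirac' _ (phi_meas x i), phi_sum', smul_eq_mul, mul_one]

lemma phi_mul {d m n : ℕ} (x : Fin m → Euc d) (y : Fin n → Euc d) (i : Fin m) (j : Fin n)
    (g : Euc d → Euc d → ENNReal) (u v : Euc d) :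
    phi x i u * phi y j v * g (x i) (y j) = phi x i u * phi y j v * g u v := by
  by_cases h : u = x i
  · by_cases h' : v = y j
    · rw [h, h']
    · simp [phi, h']
  · simp [phi, h]

lemma exists_TM {d m n : ℕ} (hm : 0 < m) (hn : 0 < n) (x : Fin m → Euc d) (y : Fin n → Euc d)
    (π : Measure (Euc d × Euc d)) (h1 : π.map Prod.fst = emp x) (h2 : π.map Prod.snd = emp y) :
    ∃ A ∈ TM m n, (cst A x y : ENNReal) = ∫⁻ p, (‖p.1 - p.2‖₊ : ENNReal) ^ 2 ∂π := by
  let a : Fin m → Fin n → ENNReal := fun i j => ∫⁻ p, phi x i p.1 * phi y j p.2 ∂π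
  have ma : ∀ i j, Measurable fun p : Euc d × Euc d => phi x i p.1 * phi y j p.2 := fun i j =>
    ((phi_meas x i).comp measurable_fst).mul ((phi_meas y j).comp measurable_snd)
  have ae1 : ∀ᵐ p ∂π, ∑ i, phi x i p.1 = 1 :=
    ae_of_ae_map measurable_fst.aemeasurable (h1 ▸ phi_ae x)
  have ae2 : ∀ᵐ p ∂π, ∑ j, phi y j p.2 = 1 :=
    ae_of_ae_map measurable_snd.aemeasurable (h2 ▸ phi_ae y)
  have hr : ∀ i, ∑ j, a i j = (m : ENNReal)⁻¹ := by
    intro i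
    simp only [a]
    rw [← lintegral_finsetSum _ (fun j _ => ma i j), ← phi_int x i, ← h1,
      lintegral_map (phi_meas x i) measurable_fst]
    refine lintegral_congr_ae ?_
    filter_upwards [ae2] with p hp
    rw [← Finset.mul_sum, hp, mul_one]
  have hc : ∀ j, ∑ i, a i j = (n : ENNReal)⁻¹ := by
    intro j
    simp only [a]
    rw [← lintegral_finsetSum _ (fun i _ => ma i j), ← phi_int y j, ← h2,
      lintegral_map (phi_meas y j) measurable_snd]
    refine lintegral_congr_ae ?_
    filter_upwards [ae1] with p hp
    rw [← Finset.sum_mul, hp, one_mul]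
  have hfin : ∀ i j, a i j ≠ ⊤ := by
    intro i j
    have : a i j ≤ (m : ENNReal)⁻¹ := by
      rw [← hr i]
      exact Finset.single_le_sum (f := fun j => a i j) (fun _ _ => zero_le) (Finset.mem_univ j)
    refine ne_top_of_le_ne_top ?_ this
    simp [hm.ne']
  have hcoe : ∀ i j, ((a i j).toNNReal : ENNReal) = a i j := fun i j =>
    ENNReal.coe_toNNReal (hfin i j)
  refine ⟨fun i j => (a i j).toNNReal, ⟨fun i => ?_, fun j => ?_⟩, ?_⟩
  · rw [← ENNReal.coe_inj]
    push_cast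
    rw [ENNReal.coe_inv (by exact_mod_cast hm.ne')]
    simp only [hcoe, hr]
    simp
  · rw [← ENNReal.coe_inj]
    push_cast
    rw [ENNReal.coe_inv (by exact_mod_cast hn.ne')]
    simp only [hcoe, hc]
    simp
  · simp only [cst]
    push_cast
    simp only [hcoe, a]
    have e : ∀ i j, (∫⁻ p, phi x i p.1 * phi y j p.2 ∂π) * (‖x i - y j‖₊ : ENNReal) ^ 2
        = ∫⁻ p, phi x i p.1 * phi y j p.2 * (‖p.1 - p.2‖₊ : ENNReal) ^ 2 ∂π := by
      intro i j
      rw [← lintegral_mul_const _ (ma i j)]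
      refine lintegral_congr fun p => ?_
      exact phi_mul x y i j (fun u v => (‖u - v‖₊ : ENNReal) ^ 2) p.1 p.2
    simp only [e]
    have mb : ∀ i j, Measurable fun p : Euc d × Euc d =>
        phi x i p.1 * phi y j p.2 * (‖p.1 - p.2‖₊ : ENNReal) ^ 2 := fun i j =>
      (ma i j).mul meas_cost
    simp only [← lintegral_finsetSum _ (fun j _ => mb _ j)]
    rw [← lintegral_finsetSum _ (fun i _ => Finset.measurable_sum _ fun j _ => mb i j)]
    refine lintegral_congr_ae ?_
    filter_upwards [ae1, ae2] with p hp hp'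
    simp only [← Finset.sum_mul, ← Finset.mul_sum, hp, hp', one_mul]

lemma TM_coe_row {m n : ℕ} (hm : 0 < m) {A : Fin m → Fin n → NNReal} (hA : A ∈ TM m n) (i : Fin m) :
    ∑ j, (A i j : ENNReal) = (m : ENNReal)⁻¹ := by
  have := congrArg (fun t : NNReal => (t : ENNReal)) (hA.1 i)
  push_cast at this
  rw [this, ENNReal.coe_inv (by exact_mod_cast hm.ne')]
  simp

lemma TM_coe_col {m n : ℕ} (hn : 0 < n) {A : Fin m → Fin n → NNReal} (hA : A ∈ TM m n) (j : Fin n) :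
    ∑ i, (A i j : ENNReal) = (n : ENNReal)⁻¹ := by
  have := congrArg (fun t : NNReal => (t : ENNReal)) (hA.2 j)
  push_cast at this
  rw [this, ENNReal.coe_inv (by exact_mod_cast hn.ne')]
  simp

lemma VV_em_le {d m n : ℕ} (hm : 0 < m) (hn : 0 < n) (x : Fin m → Euc d) (y : Fin n → Euc d)
    {A : Fin m → Fin n → NNReal} (hA : A ∈ TM m n) : VV (emp x) (emp y) ≤ cst A x y := by
  have h := VV_le hm (Measure.dirac ()) (fun i _ => x i) (fun j _ => y j)
    (fun _ => measurable_const) (fun _ => measurable_const) (fun i j _ => (A i j : ENNReal))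
    (fun _ _ => measurable_const) (fun i _ => TM_coe_row hm hA i) (fun j _ => TM_coe_col hn hA j)
  simp only [Measure.map_const, measure_univ, one_smul, lintegral_const, mul_one] at h
  refine h.trans (le_of_eq ?_)
  simp only [cst]
  push_cast
  rfl

lemma TM_nonempty {m n : ℕ} (hm : 0 < m) (hn : 0 < n) : (TM m n).Nonempty := by
  refine ⟨fun _ _ => (m : NNReal)⁻¹ * (n : NNReal)⁻¹, fun i => ?_, fun j => ?_⟩
  · have : (n : NNReal) ≠ 0 := by exact_mod_cast hn.ne'
    simp; field_simp
  · have : (m : NNReal) ≠ 0 := by exact_mod_cast hm.ne'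
    simp; field_simp

lemma VV_em_eq {d m n : ℕ} (hm : 0 < m) (hn : 0 < n) (B : ℕ → TM m n) (hB : DenseRange B)
    (x : Fin m → Euc d) (y : Fin n → Euc d) :
    VV (emp x) (emp y) = ⨅ k, (cst (B k).1 x y : ENNReal) := by
  refine le_antisymm (le_iInf fun k => VV_em_le hm hn x y (B k).2) ?_
  refine le_iInf₂ fun π hπ => ?_
  obtain ⟨A, hA, hAe⟩ := exists_TM hm hn x y π hπ.2.1 hπ.2.2
  rw [← hAe]
  refine le_of_forall_gt fun c hc => ?_
  have ho : IsOpen {A : TM m n | (cst A.1 x y : ENNReal) < c} := by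
    refine isOpen_lt ?_ continuous_const
    refine ENNReal.continuous_coe.comp ?_
    unfold cst
    refine continuous_finsetSum _ fun i _ => continuous_finsetSum _ fun j _ => ?_
    have h1 : Continuous fun A : TM m n => A.1 i j :=
      (continuous_apply_apply i j).comp continuous_subtype_val
    exact h1.mul continuous_const
  obtain ⟨k, hk⟩ := hB.exists_mem_open ho ⟨⟨A, hA⟩, hc⟩
  exact (iInf_le _ k).trans_lt hk

lemma law_avg {d m : ℕ} (hm : 0 < m) {Ω : Type*} [MeasurableSpace Ω] (P : Measure Ω)
    (μ : Measure (Euc d)) (X : Fin m → Ω → Euc d) (h : ∀ i, P.map (X i) = μ) :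
    (m : ENNReal)⁻¹ • ∑ i, P.map (X i) = μ := by
  simp only [h, Finset.sum_const, Finset.card_univ, Fintype.card_fin]
  rw [← Nat.cast_smul_eq_nsmul ENNReal, smul_smul,
    ENNReal.inv_mul_cancel (by exact_mod_cast hm.ne') (by simp), one_smul]

lemma lint_sq {d : ℕ} {Ω : Type*} [MeasurableSpace Ω] (P : Measure Ω)
    (μ : Measure (Euc d)) (hμ2 : Integrable (fun x => ‖x‖ ^ 2) μ) (X : Ω → Euc d)
    (hX : Measurable X) (h : P.map X = μ) : ∫⁻ ω, (‖X ω‖₊ : ENNReal) ^ 2 ∂P < ⊤ := by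
  have h2 := hμ2.2
  rw [← h] at h2
  unfold HasFiniteIntegral at h2
  rw [lintegral_map (by fun_prop) hX] at h2
  refine lt_of_le_of_lt (le_of_eq ?_) h2
  refine lintegral_congr fun ω => ?_
  rw [enorm_pow, enorm_norm]
  rfl

lemma sq_bound {d : ℕ} (u v : Euc d) : (‖u - v‖₊ : ENNReal) ^ 2 ≤
    2 * (‖u‖₊ : ENNReal) ^ 2 + 2 * (‖v‖₊ : ENNReal) ^ 2 := by
  have : ‖u - v‖₊ ^ 2 ≤ 2 * ‖u‖₊ ^ 2 + 2 * ‖v‖₊ ^ 2 := by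
    rw [← NNReal.coe_le_coe]
    push_cast
    have := norm_sub_le u v
    nlinarith [norm_nonneg (u - v), sq_nonneg (‖u‖ - ‖v‖)]
  exact_mod_cast this

/-- **Lemma (positive bias of the plug-in estimator).** For samples `X₁,…,Xₘ ∼ μ` and
`Y₁,…,Yₙ ∼ ν` with arbitrary joint dependence, `E[W₂²(μ̂ₘ, ν̂ₙ)] ≥ W₂²(μ, ν)`. -/
theorem empirical_w2sq_positive_bias {d m n : ℕ} (hm : 0 < m) (hn : 0 < n)
    {Ω : Type*} [MeasurableSpace Ω] (P : Measure Ω) [IsProbabilityMeasure P]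
    (μ ν : Measure (Euc d)) [IsProbabilityMeasure μ] [IsProbabilityMeasure ν]
    (hμ2 : Integrable (fun x => ‖x‖ ^ 2) μ) (hν2 : Integrable (fun y => ‖y‖ ^ 2) ν)
    (X : Fin m → Ω → Euc d) (Y : Fin n → Ω → Euc d)
    (hXmeas : ∀ i, Measurable (X i)) (hYmeas : ∀ j, Measurable (Y j))
    (hXlaw : ∀ i, P.map (X i) = μ) (hYlaw : ∀ j, P.map (Y j) = ν) :
    W2sq μ ν ≤ ∫ ω, W2sq (empMeas X ω) (empMeas Y ω) ∂P := by
  classical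
  have : Nonempty (TM m n) := (TM_nonempty hm hn).to_subtype
  let B : ℕ → TM m n := TopologicalSpace.denseSeq (TM m n)
  have hB : DenseRange B := TopologicalSpace.denseRange_denseSeq _
  let xs : Ω → Fin m → Euc d := fun ω i => X i ω
  let ys : Ω → Fin n → Euc d := fun ω j => Y j ω
  let V : Ω → ENNReal := fun ω => VV (emp (xs ω)) (emp (ys ω))
  have hVeq : ∀ ω, V ω = ⨅ k, (cst (B k).1 (xs ω) (ys ω) : ENNReal) := fun ω =>
    VV_em_eq hm hn B hB _ _
  have hcm : ∀ k, Measurable fun ω => (cst (B k).1 (xs ω) (ys ω) : ENNReal) := by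
    intro k
    simp only [cst, xs, ys]
    refine measurable_coe_nnreal_ennreal.comp ?_
    refine Finset.measurable_sum _ fun i _ => Finset.measurable_sum _ fun j _ => ?_
    exact ((((hXmeas i).sub (hYmeas j)).nnnorm).pow_const 2).const_mul _
  have hVm : Measurable V := by
    have : V = fun ω => ⨅ k, (cst (B k).1 (xs ω) (ys ω) : ENNReal) := funext hVeq
    rw [this]
    exact Measurable.iInf hcm
  have hVlt : ∀ ω, V ω < ⊤ := fun ω => by
    rw [hVeq]
    exact (iInf_le _ 0).trans_lt ENNReal.coe_lt_top
  have hVint : ∫⁻ ω, V ω ∂P ≠ ⊤ := by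
    have hle : ∫⁻ ω, V ω ∂P ≤ ∫⁻ ω, ∑ i, ∑ j, ((B 0).1 i j : ENNReal) *
        (2 * (‖X i ω‖₊ : ENNReal) ^ 2 + 2 * (‖Y j ω‖₊ : ENNReal) ^ 2) ∂P := by
      refine lintegral_mono fun ω => ?_
      rw [hVeq]
      refine (iInf_le _ 0).trans ?_
      simp only [cst]
      push_cast
      exact Finset.sum_le_sum fun i _ => Finset.sum_le_sum fun j _ =>
        mul_le_mul_right (sq_bound _ _) _
    refine ne_top_of_le_ne_top ?_ hle
    have mX : ∀ i, Measurable fun ω => (‖X i ω‖₊ : ENNReal) ^ 2 := fun i =>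
      (hXmeas i).nnnorm.coe_nnreal_ennreal.pow_const 2
    have mY : ∀ j, Measurable fun ω => (‖Y j ω‖₊ : ENNReal) ^ 2 := fun j =>
      (hYmeas j).nnnorm.coe_nnreal_ennreal.pow_const 2
    have mm : ∀ i j, Measurable fun ω => ((B 0).1 i j : ENNReal) *
        (2 * (‖X i ω‖₊ : ENNReal) ^ 2 + 2 * (‖Y j ω‖₊ : ENNReal) ^ 2) := fun i j =>
      (((mX i).const_mul _).add ((mY j).const_mul _)).const_mul _
    rw [lintegral_finsetSum _ (fun i _ => Finset.measurable_sum _ fun j _ => mm i j)]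
    refine ENNReal.sum_ne_top.2 fun i _ => ?_
    rw [lintegral_finsetSum _ (fun j _ => mm i j)]
    refine ENNReal.sum_ne_top.2 fun j _ => ?_
    have m2 : Measurable fun ω => 2 * (‖X i ω‖₊ : ENNReal) ^ 2 + 2 * (‖Y j ω‖₊ : ENNReal) ^ 2 :=
      ((mX i).const_mul _).add ((mY j).const_mul _)
    rw [lintegral_const_mul _ m2,
      lintegral_add_left ((mX i).const_mul _), lintegral_const_mul _ (mX i),
      lintegral_const_mul _ (mY j)]
    refine ENNReal.mul_ne_top ENNReal.coe_ne_top (ENNReal.add_ne_top.2 ⟨?_, ?_⟩)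
    · exact ENNReal.mul_ne_top (by simp) (lint_sq P μ hμ2 _ (hXmeas i) (hXlaw i)).ne
    · exact ENNReal.mul_ne_top (by simp) (lint_sq P ν hν2 _ (hYmeas j) (hYlaw j)).ne
  have key : VV μ ν ≤ ∫⁻ ω, V ω ∂P := by
    refine ENNReal.le_of_forall_pos_le_add fun ε hε _ => ?_
    have hex : ∀ ω, ∃ k, (cst (B k).1 (xs ω) (ys ω) : ENNReal) ≤ V ω + ε := by
      intro ω
      have : (⨅ k, (cst (B k).1 (xs ω) (ys ω) : ENNReal)) < V ω + ε := by
        rw [← hVeq]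
        exact ENNReal.lt_add_right (hVlt ω).ne (by exact_mod_cast hε.ne')
      obtain ⟨k, hk⟩ := iInf_lt_iff.1 this
      exact ⟨k, hk.le⟩
    obtain ⟨K, hK, hKs⟩ : ∃ K : Ω → ℕ, Measurable K ∧
        ∀ ω, (cst (B (K ω)).1 (xs ω) (ys ω) : ENNReal) ≤ V ω + ε :=
      ⟨fun ω => Nat.find (hex ω), measurable_find hex fun k =>
        measurableSet_le (hcm k) (hVm.add_const _), fun ω => Nat.find_spec (hex ω)⟩
    have h := VV_le hm P X Y hXmeas hYmeas (fun i j ω => ((B (K ω)).1 i j : ENNReal))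
      (fun i j => (measurable_from_nat (f := fun k => ((B k).1 i j : ENNReal))).comp hK)
      (fun i ω => TM_coe_row hm (B (K ω)).2 i) (fun j ω => TM_coe_col hn (B (K ω)).2 j)
    rw [law_avg hm P μ X hXlaw, law_avg hn P ν Y hYlaw] at h
    refine h.trans ?_
    calc _ ≤ ∫⁻ ω, (V ω + ε) ∂P := by
          refine lintegral_mono fun ω => ?_
          refine le_trans (le_of_eq ?_) (hKs ω)
          simp only [cst]
          push_cast
          rfl
      _ = _ := by rw [lintegral_add_left hVm]; simp
  have hI : ∫ ω, W2sq (empMeas X ω) (empMeas Y ω) ∂P = (∫⁻ ω, V ω ∂P).toReal :=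
    integral_toReal hVm.aemeasurable (Filter.Eventually.of_forall hVlt)
  rw [hI]
  exact ENNReal.toReal_mono hVint key

end
end

section
/- Let μ and ν be probability measures on ℝ^d with densities dμ(x) = e^{−U(x)} dx and dν(x) = e^{−V(x)} dx with respect to Lebesgue measure, where U and V are twice continuously differentiable. Suppose there exists a symmetric positive definite d×d matrix A such that for all x ∈ ℝ^d the Hessians satisfy ∇²U(x) ⪰ A ⪰ ∇²V(x) in the Loewner order. Then ν is contractively optimally transported to μ: there exists a differentiable convex function φ̃ : ℝ^d → ℝ with 1-Lipschitz gradient such that the pushforward of ν under ∇φ̃ equals μ. -/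
open MeasureTheory

noncomputable section

/-- `ν` is contractively optimally transported to `μ`: there is a differentiable convex
potential whose gradient is a 1-Lipschitz map pushing `ν` forward to `μ`. -/
def ContractiveOT {d : ℕ} (ν μ : Measure (Euc d)) : Prop :=
  ∃ φ : Euc d → ℝ, ConvexOn ℝ Set.univ φ ∧ Differentiable ℝ φ ∧
    LipschitzWith 1 (gradient φ) ∧ ν.map (gradient φ) = μ

section Part1

namespace Caff
open Set Filter Topology
open scoped ENNReal Pointwise

theorem amgm_ennreal (x y : ℝ≥0∞) {a b : ℝ} (ha : 0 < a) (hb : 0 < b) (hab : a + b = 1) :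
    x ^ a * y ^ b ≤ ENNReal.ofReal a * x + ENNReal.ofReal b * y := by
  have ha' : ENNReal.ofReal a ≠ 0 := by simpa using ha
  have hb' : ENNReal.ofReal b ≠ 0 := by simpa using hb
  rcases eq_or_ne x ⊤ with rfl | hx
  · rw [ENNReal.mul_top ha']; simp
  rcases eq_or_ne y ⊤ with rfl | hy
  · rw [ENNReal.mul_top hb']; simp
  have h := Real.geom_mean_le_arith_mean2_weighted ha.le hb.le (ENNReal.toReal_nonneg (a := x))
    (ENNReal.toReal_nonneg (a := y)) hab
  have h2 := ENNReal.ofReal_le_ofReal h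
  rw [ENNReal.ofReal_mul (by positivity), ENNReal.ofReal_add (by positivity) (by positivity),
    ENNReal.ofReal_mul ha.le, ENNReal.ofReal_mul hb.le,
    ← ENNReal.ofReal_rpow_of_nonneg ENNReal.toReal_nonneg ha.le,
    ← ENNReal.ofReal_rpow_of_nonneg ENNReal.toReal_nonneg hb.le,
    ENNReal.ofReal_toReal hx, ENNReal.ofReal_toReal hy] at h2
  exact h2

theorem bm_compact (A B : Set ℝ) (hA : IsCompact A) (hB : IsCompact B) (hA0 : A.Nonempty)
    (hB0 : B.Nonempty) : volume A + volume B ≤ volume (A + B) := by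
  set s := sSup A
  set i := sInf B
  have hs : s ∈ A := hA.sSup_mem hA0
  have hi : i ∈ B := hB.sInf_mem hB0
  have h1 : volume A = volume ((fun x => x + i) '' A) := by
    simp
  have h2 : volume B = volume ((fun x => s + x) '' B) := by
    simp
  have hm : MeasurableSet ((fun x => s + x) '' B) :=
    (hB.image (by fun_prop)).measurableSet
  rw [h1, h2, ← measure_union₀ hm.nullMeasurableSet]
  · apply measure_mono
    rintro x (⟨y, hy, rfl⟩ | ⟨y, hy, rfl⟩)
    · exact add_mem_add hy hi
    · exact add_mem_add hs hy
  · refine measure_mono_null (t := {s + i}) ?_ (by simp)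
    rintro x ⟨⟨y, hy, rfl⟩, ⟨z, hz, hzy⟩⟩
    have := le_csSup hA.bddAbove hy
    have := csInf_le hB.bddBelow hz
    simp only [mem_singleton_iff] at *
    change s + z = y + i at hzy
    change y + i = s + i
    linarith

theorem bm_one (A B : Set ℝ) (hA : MeasurableSet A) (hB : MeasurableSet B) (hA0 : A.Nonempty)
    (hB0 : B.Nonempty) : volume A + volume B ≤ volume (A + B) := by
  obtain ⟨x0, hx0⟩ := hA0
  obtain ⟨y0, hy0⟩ := hB0
  have hAle : volume A ≤ volume (A + B) := by
    calc volume A = volume ((fun x => x + y0) '' A) := by simp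
      _ ≤ _ := measure_mono (by rintro _ ⟨y, hy, rfl⟩; exact add_mem_add hy hy0)
  have hBle : volume B ≤ volume (A + B) := by
    calc volume B = volume ((fun x => x0 + x) '' B) := by simp
      _ ≤ _ := measure_mono (by rintro _ ⟨y, hy, rfl⟩; exact add_mem_add hx0 hy)
  rcases eq_or_ne (volume A) 0 with h0 | h0
  · rw [h0, zero_add]; exact hBle
  rcases eq_or_ne (volume B) 0 with h0' | h0'
  · rw [h0', add_zero]; exact hAle
  refine le_of_forall_lt fun c hc => ?_
  obtain ⟨a', ha', b', hb', hc'⟩ := ENNReal.exists_lt_add_of_lt_add hc h0 h0'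
  obtain ⟨K, hKA, hK, hK'⟩ := hA.exists_lt_isCompact ha'
  obtain ⟨L, hLB, hL, hL'⟩ := hB.exists_lt_isCompact hb'
  have hK0 : K.Nonempty := nonempty_of_measure_ne_zero (ne_bot_of_gt hK')
  have hL0 : L.Nonempty := nonempty_of_measure_ne_zero (ne_bot_of_gt hL')
  calc c < a' + b' := hc'
    _ ≤ volume K + volume L := by gcongr
    _ ≤ volume (K + L) := bm_compact K L hK hL hK0 hL0
    _ ≤ _ := measure_mono (add_subset_add hKA hLB)

theorem bm_weighted (A B C : Set ℝ) (hA : MeasurableSet A) (hB : MeasurableSet B)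
    (hA0 : A.Nonempty) (hB0 : B.Nonempty) {a b : ℝ} (ha : 0 < a) (hb : 0 < b)
    (hC : ∀ x ∈ A, ∀ y ∈ B, a * x + b * y ∈ C) :
    ENNReal.ofReal a * volume A + ENNReal.ofReal b * volume B ≤ volume C := by
  have h := bm_one (a • A) (b • B) (hA.const_smul₀ a) (hB.const_smul₀ b) hA0.smul_set hB0.smul_set
  rw [Measure.addHaar_smul, Measure.addHaar_smul] at h
  simp only [Module.finrank_self, pow_one, abs_of_pos ha, abs_of_pos hb] at h
  refine h.trans (measure_mono ?_)
  rintro _ ⟨_, ⟨x, hx, rfl⟩, _, ⟨y, hy, rfl⟩, rfl⟩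
  simpa using hC x hx y hy

/-- One-dimensional additive form for normalized functions. -/
theorem pl_norm (f g h : ℝ → ℝ) (hf : Measurable f) (hg : Measurable g) (hh : Measurable h)
    (hf0 : ∀ x, 0 ≤ f x) (hg0 : ∀ x, 0 ≤ g x) (hh0 : ∀ x, 0 ≤ h x)
    (hf1 : ∀ x, f x ≤ 1) (hg1 : ∀ x, g x ≤ 1)
    (hfs : ∀ s < 1, ∃ x, s < f x) (hgs : ∀ s < 1, ∃ x, s < g x)
    {a b : ℝ} (ha : 0 < a) (hb : 0 < b) (hab : a + b = 1)
    (H : ∀ x y, f x ^ a * g y ^ b ≤ h (a * x + b * y)) :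
    ENNReal.ofReal a * (∫⁻ x, ENNReal.ofReal (f x)) + ENNReal.ofReal b * (∫⁻ x, ENNReal.ofReal (g x))
      ≤ ∫⁻ x, ENNReal.ofReal (h x) := by
  rw [lintegral_eq_lintegral_meas_lt _ (ae_of_all _ hf0) hf.aemeasurable,
    lintegral_eq_lintegral_meas_lt _ (ae_of_all _ hg0) hg.aemeasurable,
    lintegral_eq_lintegral_meas_lt _ (ae_of_all _ hh0) hh.aemeasurable]
  have mf : Measurable fun t => volume {x | t < f x} :=
    Antitone.measurable (fun s t hst => measure_mono (fun x hx => lt_of_le_of_lt hst hx))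
  have mg : Measurable fun t => volume {x | t < g x} :=
    Antitone.measurable (fun s t hst => measure_mono (fun x hx => lt_of_le_of_lt hst hx))
  rw [← lintegral_const_mul _ mf, ← lintegral_const_mul _ mg,
    ← lintegral_add_left (mf.const_mul _)]
  refine setLIntegral_mono' measurableSet_Ioi fun s hs => ?_
  rcases lt_or_ge s 1 with hs1 | hs1
  · refine bm_weighted _ _ _ (measurableSet_lt measurable_const hf)
      (measurableSet_lt measurable_const hg) (hfs s hs1) (hgs s hs1) ha hb ?_
    intro x hx y hy
    simp only [mem_ofPred_eq] at *
    refine lt_of_lt_of_le ?_ (H x y)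
    calc s = s ^ a * s ^ b := by
          rw [← Real.rpow_add hs, hab, Real.rpow_one]
      _ < _ := mul_lt_mul'' (Real.rpow_lt_rpow (le_of_lt hs) hx ha)
          (Real.rpow_lt_rpow (le_of_lt hs) hy hb) (Real.rpow_nonneg (le_of_lt hs) _)
          (Real.rpow_nonneg (le_of_lt hs) _)
  · have e1 : {x | s < f x} = ∅ := by
      ext x; simp; linarith [hf1 x]
    have e2 : {x | s < g x} = ∅ := by
      ext x; simp; linarith [hg1 x]
    simp [e1, e2]

theorem pl_bdd (f g h : ℝ → ℝ≥0∞) (hf : Measurable f) (hg : Measurable g) (hh : Measurable h)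
    {N : ℝ≥0∞} (hN : N ≠ ⊤) (hfN : ∀ x, f x ≤ N) (hgN : ∀ x, g x ≤ N)
    {a b : ℝ} (ha : 0 < a) (hb : 0 < b) (hab : a + b = 1)
    (H : ∀ x y, f x ^ a * g y ^ b ≤ h (a * x + b * y)) :
    (∫⁻ x, f x) ^ a * (∫⁻ x, g x) ^ b ≤ ∫⁻ x, h x := by
  set p := ⨆ x, f x with hp
  set q := ⨆ x, g x with hq
  have hpN : p ≠ ⊤ := ne_top_of_le_ne_top hN (iSup_le hfN)
  have hqN : q ≠ ⊤ := ne_top_of_le_ne_top hN (iSup_le hgN)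
  have hfp : ∀ x, f x ≤ p := fun x => le_iSup f x
  have hgq : ∀ x, g x ≤ q := fun x => le_iSup g x
  rcases eq_or_ne p 0 with hp0 | hp0
  · have : ∀ x, f x = 0 := fun x => by simpa [hp0] using hfp x
    simp [this, ha]
  rcases eq_or_ne q 0 with hq0 | hq0
  · have : ∀ x, g x = 0 := fun x => by simpa [hq0] using hgq x
    simp [this, hb]
  set c := p ^ a * q ^ b with hc
  have hpa0 : p ^ a ≠ 0 := (ENNReal.rpow_pos (pos_iff_ne_zero.2 hp0) hpN).ne'
  have hqb0 : q ^ b ≠ 0 := (ENNReal.rpow_pos (pos_iff_ne_zero.2 hq0) hqN).ne'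
  have hpat : p ^ a ≠ ⊤ := ENNReal.rpow_ne_top_of_nonneg ha.le hpN
  have hqbt : q ^ b ≠ ⊤ := ENNReal.rpow_ne_top_of_nonneg hb.le hqN
  have hc0 : c ≠ 0 := mul_ne_zero hpa0 hqb0
  have hct : c ≠ ⊤ := ENNReal.mul_ne_top hpat hqbt
  have hf1 : ∀ x, f x / p ≤ 1 := fun x => ENNReal.div_le_of_le_mul (by simpa using hfp x)
  have hg1 : ∀ x, g x / q ≤ 1 := fun x => ENNReal.div_le_of_le_mul (by simpa using hgq x)
  have hh1 : ∀ x, min (h x) c / c ≤ 1 :=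
    fun x => ENNReal.div_le_of_le_mul (by simp)
  have tf : ∀ x, f x / p ≠ ⊤ := fun x => ne_top_of_le_ne_top ENNReal.one_ne_top (hf1 x)
  have tg : ∀ x, g x / q ≠ ⊤ := fun x => ne_top_of_le_ne_top ENNReal.one_ne_top (hg1 x)
  have th : ∀ x, min (h x) c / c ≠ ⊤ := fun x => ne_top_of_le_ne_top ENNReal.one_ne_top (hh1 x)
  have key := pl_norm (fun x => (f x / p).toReal) (fun x => (g x / q).toReal)
    (fun x => (min (h x) c / c).toReal) (by fun_prop) (by fun_prop) (by fun_prop)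
    (fun x => ENNReal.toReal_nonneg) (fun x => ENNReal.toReal_nonneg)
    (fun x => ENNReal.toReal_nonneg)
    (fun x => by simpa using ENNReal.toReal_mono ENNReal.one_ne_top (hf1 x))
    (fun x => by simpa using ENNReal.toReal_mono ENNReal.one_ne_top (hg1 x))
    ?_ ?_ ha hb hab ?_
  · simp only [ENNReal.ofReal_toReal (tf _), ENNReal.ofReal_toReal (tg _),
      ENNReal.ofReal_toReal (th _)] at key
    have k2 := (amgm_ennreal (∫⁻ x, f x / p) (∫⁻ x, g x / q) ha hb hab).trans key
    simp only [div_eq_mul_inv] at k2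
    rw [lintegral_mul_const _ hf, lintegral_mul_const _ hg,
      lintegral_mul_const _ (by fun_prop), ENNReal.mul_rpow_of_nonneg _ _ ha.le,
      ENNReal.mul_rpow_of_nonneg _ _ hb.le, ENNReal.inv_rpow, ENNReal.inv_rpow] at k2
    have e : (∫⁻ x, f x) ^ a * (p ^ a)⁻¹ * ((∫⁻ x, g x) ^ b * (q ^ b)⁻¹)
      = ((∫⁻ x, f x) ^ a * (∫⁻ x, g x) ^ b) * c⁻¹ := by
      rw [hc, ENNReal.mul_inv (Or.inl hpa0) (Or.inl hpat)]; ring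
    rw [e, ENNReal.mul_le_mul_iff_left (by simpa using hct) (by simpa using hc0)] at k2
    exact k2.trans (lintegral_mono fun x => min_le_left _ _)
  · intro s hs
    rcases lt_or_ge s 0 with h0 | h0
    · exact ⟨0, h0.trans_le ENNReal.toReal_nonneg⟩
    have : ENNReal.ofReal s * p < p := by
      calc ENNReal.ofReal s * p < 1 * p :=
            (ENNReal.mul_lt_mul_iff_left hp0 hpN).2 (by simpa using hs)
        _ = p := one_mul p
    obtain ⟨x, hx⟩ := lt_iSup_iff.1 this
    refine ⟨x, ?_⟩
    rw [← ENNReal.ofReal_lt_iff_lt_toReal h0 (tf x)]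
    exact (ENNReal.lt_div_iff_mul_lt (Or.inl hp0) (Or.inl hpN)).2 hx
  · intro s hs
    rcases lt_or_ge s 0 with h0 | h0
    · exact ⟨0, h0.trans_le ENNReal.toReal_nonneg⟩
    have : ENNReal.ofReal s * q < q := by
      calc ENNReal.ofReal s * q < 1 * q :=
            (ENNReal.mul_lt_mul_iff_left hq0 hqN).2 (by simpa using hs)
        _ = q := one_mul q
    obtain ⟨x, hx⟩ := lt_iSup_iff.1 this
    refine ⟨x, ?_⟩
    rw [← ENNReal.ofReal_lt_iff_lt_toReal h0 (tg x)]
    exact (ENNReal.lt_div_iff_mul_lt (Or.inl hq0) (Or.inl hqN)).2 hx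
  · intro x y
    rw [ENNReal.toReal_rpow, ENNReal.toReal_rpow, ← ENNReal.toReal_mul]
    refine ENNReal.toReal_mono (th _) ?_
    rw [ENNReal.div_rpow_of_nonneg _ _ ha.le, ENNReal.div_rpow_of_nonneg _ _ hb.le]
    simp only [div_eq_mul_inv]
    have e : f x ^ a * (p ^ a)⁻¹ * (g y ^ b * (q ^ b)⁻¹) = (f x ^ a * g y ^ b) * c⁻¹ := by
      rw [hc, ENNReal.mul_inv (Or.inl hpa0) (Or.inl hpat)]; ring
    rw [e]
    gcongr
    refine le_min (H x y) ?_
    rw [hc]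
    gcongr
    · exact hfp x
    · exact hgq y

theorem pl_one (f g h : ℝ → ℝ≥0∞) (hf : Measurable f) (hg : Measurable g) (hh : Measurable h)
    {a b : ℝ} (ha : 0 < a) (hb : 0 < b) (hab : a + b = 1)
    (H : ∀ x y, f x ^ a * g y ^ b ≤ h (a * x + b * y)) :
    (∫⁻ x, f x) ^ a * (∫⁻ x, g x) ^ b ≤ ∫⁻ x, h x := by
  have conv : ∀ f : ℝ → ℝ≥0∞, Measurable f →
      Tendsto (fun n : ℕ => ∫⁻ x, min (f x) n) atTop (𝓝 (∫⁻ x, f x)) := by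
    intro f hf
    refine lintegral_tendsto_of_tendsto_of_monotone (fun n => by fun_prop) ?_ ?_
    · refine ae_of_all _ fun x n m hnm => ?_
      have : (n : ℝ≥0∞) ≤ m := by exact_mod_cast hnm
      exact min_le_min le_rfl this
    · refine ae_of_all _ fun x => ?_
      have := (tendsto_const_nhds (x := f x)).min ENNReal.tendsto_nat_nhds_top
      simpa using this
  rcases eq_or_ne (∫⁻ x, f x) 0 with h0 | h0
  · simp [h0, ha]
  rcases eq_or_ne (∫⁻ x, g x) 0 with h1 | h1
  · simp [h1, hb]
  have hpow : ∀ {x : ℝ≥0∞} {r : ℝ}, x ≠ 0 → 0 < r → x ^ r ≠ 0 := by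
    intro x r hx hr
    simp [ENNReal.rpow_eq_zero_iff, hx, not_lt.2 hr.le]
  have L := ENNReal.Tendsto.mul ((conv f hf).ennrpow_const a) (Or.inl (hpow h0 ha))
    ((conv g hg).ennrpow_const b) (Or.inl (hpow h1 hb))
  refine le_of_tendsto' L fun n => ?_
  refine pl_bdd _ _ h (by fun_prop) (by fun_prop) hh (ENNReal.natCast_ne_top n)
    (fun x => min_le_right _ _) (fun x => min_le_right _ _) ha hb hab fun x y => ?_
  refine le_trans ?_ (H x y)
  gcongr
  · exact min_le_left _ _
  · exact min_le_left _ _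

theorem pl_pi (n : ℕ) (f g h : (Fin n → ℝ) → ℝ≥0∞) (hf : Measurable f) (hg : Measurable g)
    (hh : Measurable h) {a b : ℝ} (ha : 0 < a) (hb : 0 < b) (hab : a + b = 1)
    (H : ∀ x y, f x ^ a * g y ^ b ≤ h (a • x + b • y)) :
    (∫⁻ x, f x) ^ a * (∫⁻ x, g x) ^ b ≤ ∫⁻ x, h x := by
  induction n with
  | zero =>
    rw [Measure.volume_pi_eq_dirac 0]
    simp only [lintegral_dirac]
    simpa using H 0 0
  | succ n ih =>
    have mp := (volume_preserving_piFinSuccAbove (fun _ : Fin (n + 1) => ℝ) 0).symm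
    set e := (MeasurableEquiv.piFinSuccAbove (fun _ : Fin (n + 1) => ℝ) 0).symm with he
    have red : ∀ f : (Fin (n + 1) → ℝ) → ℝ≥0∞, Measurable f →
        ∫⁻ x, f x = ∫⁻ s : ℝ, ∫⁻ z : Fin n → ℝ, f (e (s, z)) := by
      intro f hf
      rw [← mp.lintegral_comp hf, Measure.volume_eq_prod]
      exact lintegral_prod _ (hf.comp e.measurable).aemeasurable
    have ms : ∀ f : (Fin (n + 1) → ℝ) → ℝ≥0∞, Measurable f →
        Measurable fun s : ℝ => ∫⁻ z : Fin n → ℝ, f (e (s, z)) := by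
      intro f hf
      exact (hf.comp e.measurable).lintegral_prod_right'
    rw [red f hf, red g hg, red h hh]
    refine pl_one _ _ _ (ms f hf) (ms g hg) (ms h hh) ha hb hab fun s t => ?_
    refine ih _ _ _ (by fun_prop) (by fun_prop) (by fun_prop) fun x y => ?_
    refine (H _ _).trans (le_of_eq ?_)
    congr 1
    ext i
    simp only [he, MeasurableEquiv.piFinSuccAbove_symm_apply]
    refine Fin.cases ?_ (fun j => ?_) i <;> simp [Fin.insertNthEquiv]

theorem pl_euc {n : ℕ} (f g h : EuclideanSpace ℝ (Fin n) → ℝ≥0∞) (hf : Measurable f)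
    (hg : Measurable g)
    (hh : Measurable h) {a b : ℝ} (ha : 0 < a) (hb : 0 < b) (hab : a + b = 1)
    (H : ∀ x y, f x ^ a * g y ^ b ≤ h (a • x + b • y)) :
    (∫⁻ x, f x) ^ a * (∫⁻ x, g x) ^ b ≤ ∫⁻ x, h x := by
  have mp := PiLp.volume_preserving_toLp (Fin n)
  rw [← mp.lintegral_comp hf, ← mp.lintegral_comp hg, ← mp.lintegral_comp hh]
  refine pl_pi n _ _ _ (hf.comp mp.measurable) (hg.comp mp.measurable) (hh.comp mp.measurable)
    ha hb hab fun x y => ?_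
  exact H _ _

end Caff

end Part1

section Part2

set_option linter.unusedSectionVars false

namespace Caff
open Set Filter Topology
open scoped ENNReal NNReal RealInnerProductSpace

theorem holder_log {α : Type*} [MeasurableSpace α] {ρ : Measure α} (hρ : ρ ≠ 0)
    {F G H : α → ℝ} (hF : Integrable (fun x => Real.exp (F x)) ρ)
    (hG : Integrable (fun x => Real.exp (G x)) ρ) (hHm : Measurable H)
    {a b : ℝ} (ha : 0 < a) (hb : 0 < b) (hab : a + b = 1)
    (hH : ∀ x, H x ≤ a * F x + b * G x) :
    Real.log (∫ x, Real.exp (H x) ∂ρ) ≤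
      a * Real.log (∫ x, Real.exp (F x) ∂ρ) + b * Real.log (∫ x, Real.exp (G x) ∂ρ) := by
  have hle : ∀ x, Real.exp (H x) ≤ Real.exp (F x) ^ a * Real.exp (G x) ^ b := by
    intro x
    rw [← Real.exp_mul, ← Real.exp_mul, ← Real.exp_add]
    exact Real.exp_le_exp.2 (by linarith [hH x])
  have hle2 : ∀ x, Real.exp (F x) ^ a * Real.exp (G x) ^ b ≤
      a * Real.exp (F x) + b * Real.exp (G x) := fun x =>
    Real.geom_mean_le_arith_mean2_weighted ha.le hb.le (Real.exp_pos _).le (Real.exp_pos _).le hab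
  have hHi : Integrable (fun x => Real.exp (H x)) ρ := by
    refine Integrable.mono' ((hF.const_mul a).add (hG.const_mul b))
      (by fun_prop) (ae_of_all _ fun x => ?_)
    rw [Real.norm_of_nonneg (Real.exp_pos _).le]
    exact (hle x).trans (hle2 x)
  have : NeZero ρ := ⟨hρ⟩
  have pF := integral_exp_pos hF
  have pG := integral_exp_pos hG
  have pH := integral_exp_pos hHi
  have key : (∫ x, Real.exp (H x) ∂ρ) ≤
      (∫ x, Real.exp (F x) ∂ρ) ^ a * (∫ x, Real.exp (G x) ∂ρ) ^ b := by
    rw [← ENNReal.ofReal_le_ofReal_iff (by positivity), ENNReal.ofReal_mul (by positivity),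
      ← ENNReal.ofReal_rpow_of_pos pF, ← ENNReal.ofReal_rpow_of_pos pG,
      ofReal_integral_eq_lintegral_ofReal hF (ae_of_all _ fun x => (Real.exp_pos _).le),
      ofReal_integral_eq_lintegral_ofReal hG (ae_of_all _ fun x => (Real.exp_pos _).le),
      ofReal_integral_eq_lintegral_ofReal hHi (ae_of_all _ fun x => (Real.exp_pos _).le)]
    refine le_trans ?_ (ENNReal.lintegral_mul_norm_pow_le hF.aemeasurable.ennreal_ofReal
      hG.aemeasurable.ennreal_ofReal ha.le hb.le hab)
    refine lintegral_mono fun x => ?_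
    dsimp only
    rw [ENNReal.ofReal_rpow_of_pos (Real.exp_pos _), ENNReal.ofReal_rpow_of_pos (Real.exp_pos _),
      ← ENNReal.ofReal_mul (by positivity)]
    exact ENNReal.ofReal_le_ofReal (hle x)
  calc _ ≤ Real.log ((∫ x, Real.exp (F x) ∂ρ) ^ a * (∫ x, Real.exp (G x) ∂ρ) ^ b) :=
        Real.log_le_log pH key
    _ = _ := by
      rw [Real.log_mul (by positivity) (by positivity), Real.log_rpow pF, Real.log_rpow pG]

variable {E : Type*} [NormedAddCommGroup E] [InnerProductSpace ℝ E] [MeasurableSpace E]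
  [BorelSpace E] [FiniteDimensional ℝ E]

/-- Entropic (soft) Legendre transform. -/
noncomputable def sl (ε : ℝ) (ρ : Measure E) (f : E → ℝ) (y : E) : ℝ :=
  ε * Real.log (∫ x, Real.exp ((⟪x, y⟫ - f x) / ε) ∂ρ)

/-- Integrability making `sl` meaningful. -/
def SI (ε : ℝ) (ρ : Measure E) (f : E → ℝ) : Prop :=
  ∀ y, Integrable (fun x => Real.exp ((⟪x, y⟫ - f x) / ε)) ρ

theorem exp_sl {ε : ℝ} (hε : 0 < ε) {ρ : Measure E} [IsProbabilityMeasure ρ] {f : E → ℝ}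
    (h : SI ε ρ f) (y : E) :
    Real.exp (sl ε ρ f y / ε) = ∫ x, Real.exp ((⟪x, y⟫ - f x) / ε) ∂ρ := by
  rw [sl, mul_div_cancel_left₀ _ hε.ne', Real.exp_log (integral_exp_pos (h y))]

theorem convexOn_univ_of_pos {f : E → ℝ}
    (h : ∀ x y : E, ∀ a b : ℝ, 0 < a → 0 < b → a + b = 1 →
      f (a • x + b • y) ≤ a * f x + b * f y) : ConvexOn ℝ univ f := by
  rw [convexOn_iff_forall_pos]
  exact ⟨convex_univ, fun x _ y _ a b ha hb hab => by simpa using h x y a b ha hb hab⟩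

theorem sl_convex {ε : ℝ} (hε : 0 < ε) {ρ : Measure E} [IsProbabilityMeasure ρ] {f : E → ℝ}
    (hf : Measurable f) (h : SI ε ρ f) : ConvexOn ℝ univ (sl ε ρ f) := by
  refine convexOn_univ_of_pos fun x y a b ha hb hab => ?_
  have := holder_log (IsProbabilityMeasure.ne_zero ρ) (h x) (h y)
    (H := fun z => (⟪z, a • x + b • y⟫ - f z) / ε) (by fun_prop) ha hb hab (fun z => by
      apply le_of_eq
      simp only [inner_add_right, inner_smul_right]
      field_simp
      have : f z = a * f z + b * f z := by rw [← add_mul, hab, one_mul]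
      linear_combination -this)
  unfold sl
  calc _ ≤ ε * _ := mul_le_mul_of_nonneg_left this hε.le
    _ = _ := by ring

theorem sl_cont {ε : ℝ} (hε : 0 < ε) {ρ : Measure E} [IsProbabilityMeasure ρ] {f : E → ℝ}
    (hf : Measurable f) (h : SI ε ρ f) : Continuous (sl ε ρ f) := by
  rw [← continuousOn_univ]
  exact (sl_convex hε hf h).continuousOn isOpen_univ

theorem norm_sq_affine (a b : ℝ) (hab : a + b = 1) (x y : E) :
    ‖a • x + b • y‖ ^ 2 = a * ‖x‖ ^ 2 + b * ‖y‖ ^ 2 - a * b * ‖x - y‖ ^ 2 := by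
  obtain rfl : b = 1 - a := by linarith
  rw [norm_add_sq_real, norm_sub_sq_real, norm_smul, norm_smul, mul_pow, mul_pow,
    inner_smul_left, inner_smul_right]
  simp only [Real.norm_eq_abs, sq_abs, conj_trivial]
  ring

theorem integral_wd {α : Type*} [MeasurableSpace α] (ρ : Measure α) {V : α → ℝ}
    (hV : Measurable V) (k : α → ℝ) :
    ∫ x, k x ∂(ρ.withDensity fun x => ENNReal.ofReal (Real.exp (-V x)))
      = ∫ x, Real.exp (-V x) * k x ∂ρ := by
  rw [integral_withDensity_eq_integral_toReal_smul (by fun_prop) (by simp)]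
  simp [ENNReal.toReal_ofReal, (Real.exp_pos _).le]

theorem integrable_wd {α : Type*} [MeasurableSpace α] (ρ : Measure α) {V : α → ℝ}
    (hV : Measurable V) (k : α → ℝ) :
    Integrable k (ρ.withDensity fun x => ENNReal.ofReal (Real.exp (-V x)))
      ↔ Integrable (fun x => Real.exp (-V x) * k x) ρ := by
  rw [integrable_withDensity_iff_integrable_smul' (by fun_prop) (by simp)]
  simp [ENNReal.toReal_ofReal, (Real.exp_pos _).le]

end Caff

end Part2

section Part3

namespace Caff
open Set Filter Topology
open scoped ENNReal NNReal RealInnerProductSpace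

/-- The source step: Hölder gives a lower Hessian bound. -/
theorem source_step {d : ℕ} {ε : ℝ} (hε : 0 < ε) {q V φ : EuclideanSpace ℝ (Fin d) → ℝ}
    (hV : Continuous V) (hφ : Continuous φ)
    (hqa : ∀ z x y : EuclideanSpace ℝ (Fin d), ∀ a b : ℝ, a + b = 1 →
      q (z + (a • x + b • y)) - q (a • x + b • y) = a * (q (z + x) - q x) + b * (q (z + y) - q y))
    (hqV : ConvexOn ℝ univ fun x => q x - V x)
    (hφc : ConvexOn ℝ univ fun x => ‖x‖ ^ 2 / 2 - φ x)
    {ν : Measure (EuclideanSpace ℝ (Fin d))} [IsProbabilityMeasure ν]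
    (hν : ν = volume.withDensity fun x => ENNReal.ofReal (Real.exp (-V x)))
    (hSI : SI ε ν φ) :
    ConvexOn ℝ univ fun y => sl ε ν φ y + ε * q y - ‖y‖ ^ 2 / 2 := by
  set F : EuclideanSpace ℝ (Fin d) → EuclideanSpace ℝ (Fin d) → ℝ := fun y z =>
    (⟪z + y, y⟫ - φ (z + y)) / ε - V (z + y) + q y - ‖y‖ ^ 2 / (2 * ε) with hF
  have hInt : ∀ y, Integrable (fun z => Real.exp (F y z)) := by
    intro y
    have h1 := hSI y
    rw [hν, integrable_wd _ hV.measurable] at h1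
    have h2 := (h1.const_mul (Real.exp (q y - ‖y‖ ^ 2 / (2 * ε)))).comp_add_right y
    refine h2.congr (ae_of_all _ fun z => ?_)
    simp only [hF, ← Real.exp_add]
    congr 1; ring
  have heq : ∀ y, sl ε ν φ y + ε * q y - ‖y‖ ^ 2 / 2 = ε * Real.log (∫ z, Real.exp (F y z)) := by
    intro y
    have e1 : ∫ z, Real.exp (F y z)
        = Real.exp (q y - ‖y‖ ^ 2 / (2 * ε)) * Real.exp (sl ε ν φ y / ε) := by
      rw [exp_sl hε hSI, hν, integral_wd _ hV.measurable, ← integral_const_mul,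
        ← integral_add_right_eq_self (fun x => Real.exp (q y - ‖y‖ ^ 2 / (2 * ε)) *
          (Real.exp (-V x) * Real.exp ((⟪x, y⟫ - φ x) / ε))) y]
      congr 1; ext z
      simp only [hF, ← Real.exp_add]
      congr 1; ring
    rw [e1, ← Real.exp_add, Real.log_exp]
    field_simp
    ring
  simp only [heq]
  refine convexOn_univ_of_pos fun x y a b ha hb hab => ?_
  have hvol : (volume : Measure (EuclideanSpace ℝ (Fin d))) ≠ 0 := NeZero.ne _
  have key := holder_log hvol (hInt x) (hInt y) (H := F (a • x + b • y)) (by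
    have := hV.measurable
    have := hφ.measurable
    simp only [hF]; fun_prop) ha hb hab (fun z => by
      have c1 := hqV.2 (mem_univ (z + x)) (mem_univ (z + y)) ha.le hb.le hab
      have c2 := hφc.2 (mem_univ (z + x)) (mem_univ (z + y)) ha.le hb.le hab
      have c3 := hqa z x y a b hab
      have ez : a • (z + x) + b • (z + y) = z + (a • x + b • y) := by
        have : z = a • z + b • z := by rw [← add_smul, hab, one_smul]
        nth_rewrite 3 [this]
        module
      rw [ez] at c1 c2
      simp only [smul_eq_mul] at c1 c2
      have id1 : ∀ w, F w z = (‖z + w‖ ^ 2 / 2 - φ (z + w)) / ε + (q (z + w) - V (z + w))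
          - (q (z + w) - q w) - ‖z‖ ^ 2 / (2 * ε) := by
        intro w
        have : ⟪z + w, w⟫ = ‖z + w‖ ^ 2 / 2 + ‖w‖ ^ 2 / 2 - ‖z‖ ^ 2 / 2 := by
          rw [norm_add_sq_real, inner_add_left, real_inner_self_eq_norm_sq]; ring
        simp only [hF, this]
        field_simp
        ring
      rw [id1, id1, id1, c3]
      have c2' : (‖z + (a • x + b • y)‖ ^ 2 / 2 - φ (z + (a • x + b • y))) / ε ≤
          a * ((‖z + x‖ ^ 2 / 2 - φ (z + x)) / ε) + b * ((‖z + y‖ ^ 2 / 2 - φ (z + y)) / ε) := by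
        calc _ ≤ (a * (‖z + x‖ ^ 2 / 2 - φ (z + x)) + b * (‖z + y‖ ^ 2 / 2 - φ (z + y))) / ε := by
              gcongr
          _ = _ := by ring
      have : ‖z‖ ^ 2 / (2 * ε) = a * (‖z‖ ^ 2 / (2 * ε)) + b * (‖z‖ ^ 2 / (2 * ε)) := by
        rw [← add_mul, hab, one_mul]
      linarith)
  calc _ ≤ ε * _ := mul_le_mul_of_nonneg_left key hε.le
    _ = _ := by ring

/-- The target step: Prékopa–Leindler gives an upper Hessian bound. -/
theorem target_step {d : ℕ} {ε : ℝ} (hε : 0 < ε) {U ψ : EuclideanSpace ℝ (Fin d) → ℝ}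
    (hU : Continuous U) (hψ : Continuous ψ) {K : Set (EuclideanSpace ℝ (Fin d))}
    (hK : MeasurableSet K) (hKc : Convex ℝ K)
    (hc : ConvexOn ℝ univ fun y => ψ y + ε * U y - ‖y‖ ^ 2 / 2)
    {μ : Measure (EuclideanSpace ℝ (Fin d))} [IsProbabilityMeasure μ]
    (hμ : μ = (volume.restrict K).withDensity fun x => ENNReal.ofReal (Real.exp (-U x)))
    (hSI : SI ε μ ψ) :
    ConvexOn ℝ univ fun x => ‖x‖ ^ 2 / 2 - sl ε μ ψ x := by
  set c : EuclideanSpace ℝ (Fin d) → ℝ := fun y => ψ y + ε * U y - ‖y‖ ^ 2 / 2 with hcdef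
  have hcm : Measurable c := by
    have := hU.measurable
    have := hψ.measurable
    simp only [hcdef]; fun_prop
  set G : EuclideanSpace ℝ (Fin d) → EuclideanSpace ℝ (Fin d) → ℝ≥0∞ := fun x =>
    K.indicator fun y => ENNReal.ofReal (Real.exp (-(‖x - y‖ ^ 2 / 2 + c y) / ε)) with hG
  have hGm : ∀ x, Measurable (G x) := by
    intro x
    exact Measurable.indicator (by fun_prop) hK
  have heq : ∀ x, ∫⁻ y, G x y = ENNReal.ofReal (Real.exp ((sl ε μ ψ x - ‖x‖ ^ 2 / 2) / ε)) := by
    intro x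
    have e1 : Real.exp ((sl ε μ ψ x - ‖x‖ ^ 2 / 2) / ε)
        = ∫ y in K, Real.exp (-(‖x - y‖ ^ 2 / 2 + c y) / ε) := by
      rw [sub_div, sub_eq_add_neg, Real.exp_add, exp_sl hε hSI, hμ, integral_wd _ hU.measurable,
        ← integral_mul_const]
      congr 1; ext y
      simp only [← Real.exp_add, hcdef]
      congr 1
      rw [norm_sub_sq_real, real_inner_comm]
      field_simp
      ring
    have e2 : Integrable (fun y => Real.exp (-(‖x - y‖ ^ 2 / 2 + c y) / ε))
        (volume.restrict K) := by
      have h1 := hSI x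
      rw [hμ, integrable_wd _ hU.measurable] at h1
      refine (h1.const_mul (Real.exp (-(‖x‖ ^ 2 / 2 / ε)))).congr (ae_of_all _ fun y => ?_)
      simp only [← Real.exp_add, hcdef]
      congr 1
      rw [norm_sub_sq_real, real_inner_comm]
      field_simp
      ring
    rw [e1, ofReal_integral_eq_lintegral_ofReal e2 (ae_of_all _ fun x => (Real.exp_pos _).le),
      ← lintegral_indicator hK]
  refine convexOn_univ_of_pos fun x y a b ha hb hab => ?_
  have key := pl_euc (G x) (G y) (G (a • x + b • y)) (hGm _) (hGm _) (hGm _) ha hb hab (by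
    intro u v
    by_cases hu : u ∈ K
    swap
    · simp [hG, hu, ha]
    by_cases hv : v ∈ K
    swap
    · simp [hG, hv, hb]
    have huv : a • u + b • v ∈ K := hKc hu hv ha.le hb.le hab
    simp only [hG, indicator_of_mem, hu, hv, huv]
    rw [ENNReal.ofReal_rpow_of_pos (Real.exp_pos _), ENNReal.ofReal_rpow_of_pos (Real.exp_pos _),
      ← ENNReal.ofReal_mul (by positivity), ← Real.exp_mul, ← Real.exp_mul, ← Real.exp_add]
    refine ENNReal.ofReal_le_ofReal (Real.exp_le_exp.2 ?_)
    have c1 := hc.2 (mem_univ u) (mem_univ v) ha.le hb.le hab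
    simp only [smul_eq_mul] at c1
    change c (a • u + b • v) ≤ a * c u + b * c v at c1
    have c2 : ‖a • x + b • y - (a • u + b • v)‖ ^ 2 ≤ a * ‖x - u‖ ^ 2 + b * ‖y - v‖ ^ 2 := by
      have : a • x + b • y - (a • u + b • v) = a • (x - u) + b • (y - v) := by module
      rw [this, norm_sq_affine a b hab]
      have : 0 ≤ a * b * ‖x - u - (y - v)‖ ^ 2 := by positivity
      linarith
    have e : -(‖x - u‖ ^ 2 / 2 + c u) / ε * a + -(‖y - v‖ ^ 2 / 2 + c v) / ε * b
      = (-(a * (‖x - u‖ ^ 2 / 2 + c u) + b * (‖y - v‖ ^ 2 / 2 + c v))) / ε := by ring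
    rw [e]
    refine (div_le_div_iff_of_pos_right hε).2 ?_
    linarith)
  rw [heq, heq, heq, ENNReal.ofReal_rpow_of_pos (Real.exp_pos _),
    ENNReal.ofReal_rpow_of_pos (Real.exp_pos _),
    ← ENNReal.ofReal_mul (by positivity), ← Real.exp_mul, ← Real.exp_mul, ← Real.exp_add,
    ENNReal.ofReal_le_ofReal_iff (Real.exp_pos _).le, Real.exp_le_exp] at key
  have e : (sl ε μ ψ x - ‖x‖ ^ 2 / 2) / ε * a + (sl ε μ ψ y - ‖y‖ ^ 2 / 2) / ε * b
      = (a * (sl ε μ ψ x - ‖x‖ ^ 2 / 2) + b * (sl ε μ ψ y - ‖y‖ ^ 2 / 2)) / ε := by ring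
  rw [e, div_le_div_iff_of_pos_right hε] at key
  linarith

end Caff

end Part3

section Part4

set_option linter.unusedSectionVars false

namespace Caff
open Set Filter Topology
open scoped ENNReal NNReal RealInnerProductSpace

variable {E : Type*} [NormedAddCommGroup E] [InnerProductSpace ℝ E] [MeasurableSpace E]
  [BorelSpace E] [FiniteDimensional ℝ E]

theorem upper_of_semiconcave {φ : E → ℝ} {g : E → E}
    (hc : ConvexOn ℝ univ fun x => ‖x‖ ^ 2 / 2 - φ x)
    (hl : ∀ x y, φ x + ⟪g x, y - x⟫ ≤ φ y) (x y : E) :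
    φ y ≤ φ x + ⟪g x, y - x⟫ + ‖y - x‖ ^ 2 / 2 := by
  have main : ∀ t : ℝ, 0 < t →
      φ y ≤ φ x + ⟪g x, y - x⟫ + ‖y - x‖ ^ 2 / 2 + t * (‖y - x‖ ^ 2 / 2) := by
    intro t ht
    obtain ⟨z, rfl⟩ : ∃ z, y = x + z := ⟨y - x, by abel⟩
    simp only [add_sub_cancel_left]
    have p1 : 0 ≤ t / (1 + t) := by positivity
    have p2 : 0 ≤ 1 / (1 + t) := by positivity
    have p3 : t / (1 + t) + 1 / (1 + t) = 1 := by field_simp; ring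
    have h1 := hc.2 (mem_univ (x + z)) (mem_univ (x - t • z)) p1 p2 p3
    have e : (t / (1 + t)) • (x + z) + (1 / (1 + t)) • (x - t • z) = x := by
      have h3 : (t / (1 + t)) + (1 / (1 + t)) = 1 := by field_simp; ring
      calc _ = ((t / (1 + t)) + (1 / (1 + t))) • x + (t / (1 + t) - 1 / (1 + t) * t) • z := by
            module
        _ = x := by rw [h3, one_smul]; ring_nf; simp
    rw [e] at h1
    have h2 := hl x (x - t • z)
    simp only [smul_eq_mul] at h1
    have e2 : ‖x - t • z‖ ^ 2 = ‖x‖ ^ 2 - 2 * t * ⟪x, z⟫ + t ^ 2 * ‖z‖ ^ 2 := by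
      rw [norm_sub_sq_real, inner_smul_right, norm_smul, mul_pow, Real.norm_eq_abs, sq_abs]; ring
    have e3 : ⟪g x, x - t • z - x⟫ = - t * ⟪g x, z⟫ := by
      have : x - t • z - x = (-t) • z := by module
      rw [this, inner_smul_right]
    rw [e3] at h2
    rw [e2, norm_add_sq_real] at h1
    have h4 : (1 + t) * (‖x‖ ^ 2 / 2 - φ x) ≤
        t * ((‖x‖ ^ 2 + 2 * ⟪x, z⟫ + ‖z‖ ^ 2) / 2 - φ (x + z))
        + ((‖x‖ ^ 2 - 2 * t * ⟪x, z⟫ + t ^ 2 * ‖z‖ ^ 2) / 2 - φ (x - t • z)) := by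
      have := mul_le_mul_of_nonneg_left h1 (by positivity : 0 ≤ 1 + t)
      refine this.trans (le_of_eq ?_)
      field_simp
    have h5 : t * φ (x + z) ≤ t * (φ x + ⟪g x, z⟫ + ‖z‖ ^ 2 / 2 + t * (‖z‖ ^ 2 / 2)) := by
      linarith
    exact le_of_mul_le_mul_left h5 ht
  have hlim : Tendsto (fun t : ℝ => φ x + ⟪g x, y - x⟫ + ‖y - x‖ ^ 2 / 2 + t * (‖y - x‖ ^ 2 / 2))
      (𝓝[>] 0) (𝓝 (φ x + ⟪g x, y - x⟫ + ‖y - x‖ ^ 2 / 2 + 0 * (‖y - x‖ ^ 2 / 2))) := by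
    refine Tendsto.mono_left ?_ nhdsWithin_le_nhds
    exact Continuous.tendsto (by fun_prop) 0
  have := ge_of_tendsto hlim (eventually_mem_nhdsWithin.mono fun t ht => main t ht)
  simpa using this

theorem lip_of_bounds {φ : E → ℝ} {g : E → E}
    (h : ∀ x y, 0 ≤ φ y - φ x - ⟪g x, y - x⟫ ∧ φ y - φ x - ⟪g x, y - x⟫ ≤ ‖y - x‖ ^ 2 / 2) :
    LipschitzWith 1 g := by
  have main : ∀ x y, φ x + ⟪g x, y - x⟫ + ‖g y - g x‖ ^ 2 / 2 ≤ φ y := by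
    intro x y
    set w := g y - g x with hw
    have h1 := (h x (y - w)).1
    have h2 := (h y (y - w)).2
    have e1 : y - w - y = -w := by abel
    have e2 : y - w - x = (y - x) - w := by abel
    rw [e1, inner_neg_right, norm_neg] at h2
    rw [e2, inner_sub_right] at h1
    have e3 : ⟪g y, w⟫ = ⟪g x, w⟫ + ‖w‖ ^ 2 := by
      rw [← real_inner_self_eq_norm_sq, ← inner_add_left]; congr 1; rw [hw]; abel
    linarith
  refine LipschitzWith.of_dist_le_mul fun x y => ?_
  rw [dist_eq_norm, dist_eq_norm]
  simp only [NNReal.coe_one, one_mul]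
  have h1 := main x y
  have h2 := main y x
  have e1 : ‖g y - g x‖ = ‖g x - g y‖ := norm_sub_rev _ _
  have e2 : ⟪g x, y - x⟫ + ⟪g y, x - y⟫ = - ⟪g x - g y, x - y⟫ := by
    rw [← neg_sub x y, inner_neg_right, inner_sub_left]; ring
  rw [e1] at h1
  have h3 : ‖g x - g y‖ ^ 2 ≤ ⟪g x - g y, x - y⟫ := by linarith
  have h4 := real_inner_le_norm (g x - g y) (x - y)
  by_contra hcon
  push Not at hcon
  have : 0 < ‖g x - g y‖ := (norm_nonneg _).trans_lt hcon
  nlinarith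

theorem jensen_exp {α : Type*} [MeasurableSpace α] {ρ : Measure α} [IsProbabilityMeasure ρ]
    {F : α → ℝ} (hF : Integrable F ρ) (hF' : Integrable (fun x => Real.exp (F x)) ρ) :
    Real.exp (∫ x, F x ∂ρ) ≤ ∫ x, Real.exp (F x) ∂ρ := by
  exact convexOn_exp.map_integral_le Real.continuous_exp.continuousOn isClosed_univ
    (by simp) hF hF'

theorem tv_bound {α : Type*} [MeasurableSpace α] {ρ : Measure α} [IsProbabilityMeasure ρ]
    {w : α → ℝ} (hw : Integrable w ρ) (hw' : Integrable (fun x => Real.exp (w x)) ρ)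
    (h1 : ∫ x, Real.exp (w x) ∂ρ = 1) {δ κ : ℝ} (hδ : - δ ≤ ∫ x, w x ∂ρ) (hκ : 0 < κ) :
    ∫ x, |Real.exp (w x) - 1| ∂ρ ≤ (1 + 1 / κ) * δ + κ := by
  have hpt : ∀ x, |Real.exp (w x) - 1| ≤ (1 + 1 / κ) * (Real.exp (w x) - 1 - w x) + κ := by
    intro x
    set s := Real.exp (w x / 2) with hs
    have hs2 : Real.exp (w x) = s ^ 2 := by
      rw [hs, ← Real.exp_nat_mul]; congr 1; push_cast; ring
    have hs0 : 0 < s := Real.exp_pos _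
    have hlog : w x / 2 ≤ s - 1 := by
      have := Real.add_one_le_exp (w x / 2); linarith
    have k1 : (s - 1) ^ 2 ≤ Real.exp (w x) - 1 - w x := by rw [hs2]; nlinarith
    have k2 : |s ^ 2 - 1| ≤ (1 + 1 / κ) * (s - 1) ^ 2 + κ := by
      have e : s ^ 2 - 1 = (s - 1) ^ 2 + 2 * (s - 1) := by ring
      have k3 : 2 * |s - 1| ≤ 1 / κ * (s - 1) ^ 2 + κ := by
        have : 0 ≤ (1 / κ) * (|s - 1| - κ) ^ 2 := by positivity
        have e2 : (1 / κ) * (|s - 1| - κ) ^ 2 = 1 / κ * |s - 1| ^ 2 - 2 * |s - 1| + κ := by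
          field_simp
          ring
        rw [e2, sq_abs] at this
        linarith
      rw [e]
      calc |(s - 1) ^ 2 + 2 * (s - 1)| ≤ |(s - 1) ^ 2| + |2 * (s - 1)| := abs_add_le _ _
        _ = (s - 1) ^ 2 + 2 * |s - 1| := by rw [abs_of_nonneg (sq_nonneg _), abs_mul]; simp
        _ ≤ _ := by linarith
    rw [hs2] at k1 ⊢
    have : (0:ℝ) ≤ 1 + 1 / κ := by positivity
    nlinarith [mul_le_mul_of_nonneg_left k1 this]
  have hi : Integrable (fun x => Real.exp (w x) - 1 - w x) ρ :=
    (hw'.sub (integrable_const 1)).sub hw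
  calc ∫ x, |Real.exp (w x) - 1| ∂ρ
      ≤ ∫ x, ((1 + 1 / κ) * (Real.exp (w x) - 1 - w x) + κ) ∂ρ :=
        integral_mono ((hw'.sub (integrable_const 1)).abs) ((hi.const_mul _).add (integrable_const κ))
          hpt
    _ = (1 + 1 / κ) * (1 - 1 - ∫ x, w x ∂ρ) + κ := by
        have i1 : Integrable (fun x => Real.exp (w x) - 1) ρ := hw'.sub (integrable_const 1)
        rw [integral_add (hi.const_mul _) (integrable_const κ), integral_const_mul,
          integral_sub i1 hw, integral_sub hw' (integrable_const 1), h1]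
        simp
    _ ≤ _ := by
        have : (0:ℝ) ≤ 1 + 1 / κ := by positivity
        gcongr
        linarith

theorem int_cont {F : Type*} [NormedAddCommGroup F] [SecondCountableTopology F]
    {μ : Measure E} [IsProbabilityMeasure μ] {R : ℝ}
    (hR : ∀ᵐ y ∂μ, ‖y‖ ≤ R) {k : E → F} (hk : Continuous k) : Integrable k μ := by
  obtain ⟨C, hC⟩ := (isCompact_closedBall (0 : E) R).exists_bound_of_continuousOn hk.continuousOn
  refine Integrable.mono' (integrable_const C) hk.aestronglyMeasurable ?_
  filter_upwards [hR] with y hy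
  exact hC y (by simpa using hy)

theorem SI_of_bdd {ε : ℝ} {μ : Measure E} [IsProbabilityMeasure μ] {R : ℝ}
    (hR : ∀ᵐ y ∂μ, ‖y‖ ≤ R) {ψ : E → ℝ} (hψ : Continuous ψ) : SI ε μ ψ :=
  fun y => int_cont hR (by fun_prop)

theorem SI_of_lip {ε : ℝ} (hε : 0 < ε) {ν : Measure E} [IsProbabilityMeasure ν] {R : ℝ≥0}
    (hν : ∀ c : ℝ, Integrable (fun x => Real.exp (c * ‖x‖)) ν)
    {φ : E → ℝ} (hφ : LipschitzWith R φ) : SI ε ν φ := by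
  intro y
  refine Integrable.mono' ((hν ((‖y‖ + R) / ε)).const_mul (Real.exp (-φ 0 / ε))) ?_
    (ae_of_all _ fun x => ?_)
  · have := hφ.continuous
    exact Continuous.aestronglyMeasurable (by fun_prop)
  · rw [Real.norm_of_nonneg (Real.exp_pos _).le, ← Real.exp_add]
    refine Real.exp_le_exp.2 ?_
    have h1 := real_inner_le_norm x y
    have h2 := hφ.dist_le_mul 0 x
    rw [Real.dist_eq, dist_eq_norm, zero_sub, norm_neg] at h2
    have h3 := le_abs_self (φ 0 - φ x)
    have e : -φ 0 / ε + (‖y‖ + R) / ε * ‖x‖ = (-φ 0 + (‖y‖ + R) * ‖x‖) / ε := by ring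
    rw [e]
    refine (div_le_div_iff_of_pos_right hε).2 ?_
    nlinarith

theorem lip_int {ν : Measure E} [IsProbabilityMeasure ν] {R : ℝ≥0}
    (hν : ∀ c : ℝ, Integrable (fun x => Real.exp (c * ‖x‖)) ν) {φ : E → ℝ}
    (hφ : LipschitzWith R φ) : Integrable φ ν := by
  refine Integrable.mono' ((integrable_const |φ 0|).add ((hν 1).const_mul R))
    hφ.continuous.aestronglyMeasurable (ae_of_all _ fun x => ?_)
  have h2 := hφ.dist_le_mul x 0
  rw [Real.dist_eq, dist_eq_norm, sub_zero] at h2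
  rw [Real.norm_eq_abs]
  simp only [one_mul, Pi.add_apply]
  have h3 := abs_sub_abs_le_abs_sub (φ x) (φ 0)
  have h4 : ‖x‖ ≤ Real.exp ‖x‖ := by linarith [Real.add_one_le_exp ‖x‖]
  have h5 := mul_le_mul_of_nonneg_left h4 R.coe_nonneg
  linarith

theorem sl_lip {ε : ℝ} (hε : 0 < ε) {μ : Measure E} [IsProbabilityMeasure μ] {R : ℝ≥0}
    (hR : ∀ᵐ y ∂μ, ‖y‖ ≤ R) {ψ : E → ℝ} (hψ : Continuous ψ) :
    LipschitzWith R (sl ε μ ψ) := by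
  have hSI : SI ε μ ψ := SI_of_bdd hR hψ
  refine LipschitzWith.of_le_add_mul R fun x y => ?_
  have h1 : Real.exp (sl ε μ ψ x / ε) ≤ Real.exp ((sl ε μ ψ y + R * dist x y) / ε) := by
    rw [add_div, Real.exp_add, exp_sl hε hSI, exp_sl hε hSI, ← integral_mul_const]
    refine integral_mono_ae (hSI x) ((hSI y).mul_const _) ?_
    filter_upwards [hR] with z hz
    rw [← Real.exp_add, ← add_div]
    refine Real.exp_le_exp.2 ((div_le_div_iff_of_pos_right hε).2 ?_)
    have : ⟪z, x⟫ - ⟪z, y⟫ ≤ R * dist x y := by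
      rw [← inner_sub_right, dist_eq_norm]
      exact (real_inner_le_norm _ _).trans (by gcongr)
    linarith
  exact (div_le_div_iff_of_pos_right hε).1 (Real.exp_le_exp.1 h1)

end Caff

end Part4

section Part5

set_option linter.unusedSectionVars false

namespace Caff
open Set Filter Topology
open scoped ENNReal NNReal RealInnerProductSpace

variable {E : Type*} [NormedAddCommGroup E] [InnerProductSpace ℝ E] [MeasurableSpace E]
  [BorelSpace E] [FiniteDimensional ℝ E]

/-- Density of the entropic plan. -/
noncomputable def pk (ε : ℝ) (φ ψ : E → ℝ) (x y : E) : ℝ :=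
  Real.exp ((⟪y, x⟫ - φ x - ψ y) / ε)

theorem pk_pos (ε : ℝ) (φ ψ : E → ℝ) (x y : E) : 0 < pk ε φ ψ x y := Real.exp_pos _

theorem pk_symm (ε : ℝ) (φ ψ : E → ℝ) (x y : E) : pk ε φ ψ x y = pk ε ψ φ y x := by
  unfold pk; rw [real_inner_comm]; congr 1; ring

theorem pk_eq (ε : ℝ) (φ ψ : E → ℝ) (x y : E) :
    pk ε φ ψ x y = Real.exp (-φ x / ε) * Real.exp ((⟪y, x⟫ - ψ y) / ε) := by
  unfold pk; rw [← Real.exp_add]; congr 1; ring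

theorem pk_integrable {ε : ℝ} {ρ : Measure E} {f : E → ℝ}
    (h : SI ε ρ f) (φ : E → ℝ) (x : E) : Integrable (fun y => pk ε φ f x y) ρ := by
  simp only [pk_eq]
  exact (h x).const_mul _

theorem pk_integral {ε : ℝ} (hε : 0 < ε) {ρ : Measure E} [IsProbabilityMeasure ρ] {f : E → ℝ}
    (h : SI ε ρ f) (φ : E → ℝ) (x : E) :
    ∫ y, pk ε φ f x y ∂ρ = Real.exp ((sl ε ρ f x - φ x) / ε) := by
  simp only [pk_eq]
  rw [integral_const_mul, ← exp_sl hε h, ← Real.exp_add]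
  congr 1; ring

theorem pk_cont {ε : ℝ} {φ ψ : E → ℝ} (hφ : Continuous φ) (hψ : Continuous ψ) :
    Continuous fun z : E × E => pk ε φ ψ z.1 z.2 := by
  unfold pk; fun_prop

/-- Barycentric projection. -/
noncomputable def bary (ε : ℝ) (μ : Measure E) (ψ : E → ℝ) (x : E) : E :=
  ∫ y, pk ε (sl ε μ ψ) ψ x y • y ∂μ

section tilt
variable {ε : ℝ} {μ : Measure E} [IsProbabilityMeasure μ] {R : ℝ} {ψ : E → ℝ}

theorem pk_cont_right (hψ : Continuous ψ) (φ : E → ℝ) (x : E) :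
    Continuous fun y => pk ε φ ψ x y := by
  unfold pk; fun_prop

theorem pk_one (hε : 0 < ε) (hR : ∀ᵐ y ∂μ, ‖y‖ ≤ R) (hψ : Continuous ψ)
    (x : E) : ∫ y, pk ε (sl ε μ ψ) ψ x y ∂μ = 1 := by
  rw [pk_integral hε (SI_of_bdd hR hψ)]; simp

theorem bary_inner (hε : 0 < ε) (hR : ∀ᵐ y ∂μ, ‖y‖ ≤ R) (hψ : Continuous ψ)
    (x z : E) :
    ∫ y, pk ε (sl ε μ ψ) ψ x y * ⟪y, z⟫ ∂μ = ⟪bary ε μ ψ x, z⟫ := by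
  unfold bary
  have hc := pk_cont_right (ε := ε) hψ (sl ε μ ψ) x
  have hi : Integrable (fun y => pk ε (sl ε μ ψ) ψ x y • y) μ :=
    int_cont hR (by fun_prop)
  rw [real_inner_comm, ← integral_inner hi]
  congr 1; ext y
  rw [inner_smul_right, real_inner_comm]

theorem pk_shift (hε : 0 < ε) (hR : ∀ᵐ y ∂μ, ‖y‖ ≤ R) (hψ : Continuous ψ)
    (x z : E) :
    ∫ y, pk ε (sl ε μ ψ) ψ x y * Real.exp (⟪y - bary ε μ ψ x, z⟫ / ε) ∂μ
      = Real.exp ((sl ε μ ψ (x + z) - sl ε μ ψ x - ⟪bary ε μ ψ x, z⟫) / ε) := by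
  have hSI : SI ε μ ψ := SI_of_bdd hR hψ
  have e : Real.exp ((sl ε μ ψ (x + z) - sl ε μ ψ x - ⟪bary ε μ ψ x, z⟫) / ε)
      = Real.exp ((- sl ε μ ψ x - ⟪bary ε μ ψ x, z⟫) / ε) * Real.exp (sl ε μ ψ (x + z) / ε) := by
    rw [← Real.exp_add]; congr 1; ring
  rw [e, exp_sl hε hSI, ← integral_const_mul]
  congr 1; ext y
  unfold pk
  rw [← Real.exp_add, ← Real.exp_add]
  congr 1
  rw [inner_sub_left, inner_add_right]
  ring

theorem sl_lower (hε : 0 < ε) (hR : ∀ᵐ y ∂μ, ‖y‖ ≤ R) (hψ : Continuous ψ)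
    (x y : E) :
    sl ε μ ψ x + ⟪bary ε μ ψ x, y - x⟫ ≤ sl ε μ ψ y := by
  have h := pk_shift hε hR hψ x (y - x)
  rw [add_sub_cancel] at h
  have hc := pk_cont_right (ε := ε) hψ (sl ε μ ψ) x
  have h1 : ∫ u, pk ε (sl ε μ ψ) ψ x u * (1 + ⟪u - bary ε μ ψ x, y - x⟫ / ε) ∂μ = 1 := by
    have e : ∀ u, pk ε (sl ε μ ψ) ψ x u * (1 + ⟪u - bary ε μ ψ x, y - x⟫ / ε)
        = pk ε (sl ε μ ψ) ψ x u * (1 - ⟪bary ε μ ψ x, y - x⟫ / ε)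
          + (pk ε (sl ε μ ψ) ψ x u * ⟪u, y - x⟫) * (1 / ε) := by
      intro u; rw [inner_sub_left]; ring
    simp only [e]
    rw [integral_add (int_cont hR (by fun_prop)) (int_cont hR (by fun_prop)),
      integral_mul_const, integral_mul_const, pk_one hε hR hψ, bary_inner hε hR hψ]
    ring
  have h2 : (1:ℝ) ≤ Real.exp ((sl ε μ ψ y - sl ε μ ψ x - ⟪bary ε μ ψ x, y - x⟫) / ε) := by
    rw [← h, ← h1]
    refine integral_mono (int_cont hR (by fun_prop)) (int_cont hR (by fun_prop)) fun u => ?_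
    refine mul_le_mul_of_nonneg_left ?_ (pk_pos _ _ _ _ _).le
    have := Real.add_one_le_exp (⟪u - bary ε μ ψ x, y - x⟫ / ε)
    linarith
  have h3 := Real.one_le_exp_iff.1 h2
  have h4 := mul_nonneg h3 hε.le
  rw [div_mul_cancel₀ _ hε.ne'] at h4
  linarith

theorem var_dir (hε : 0 < ε) (hR : ∀ᵐ y ∂μ, ‖y‖ ≤ R) (hψ : Continuous ψ)
    (hu : ∀ x y, sl ε μ ψ y ≤ sl ε μ ψ x + ⟪bary ε μ ψ x, y - x⟫ + ‖y - x‖ ^ 2 / 2)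
    (x v : E) (hv : ‖v‖ = 1) :
    ∫ y, pk ε (sl ε μ ψ) ψ x y * ⟪v, y - bary ε μ ψ x⟫ ^ 2 ∂μ ≤ 4 * ε := by
  have hc := pk_cont_right (ε := ε) hψ (sl ε μ ψ) x
  have hsq : 0 < √ε := Real.sqrt_pos.2 hε
  have hsq2 : √ε * √ε = ε := Real.mul_self_sqrt hε.le
  have half : Real.exp (1 / 2) ≤ 2 := by
    have h1 : Real.exp (1 / 2) * Real.exp (1 / 2) = Real.exp 1 := by
      rw [← Real.exp_add]; norm_num
    have h2 := Real.exp_one_lt_d9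
    nlinarith [Real.exp_pos (1 / 2)]
  have hb : ∀ w : E, ‖w‖ = 1 →
      ∫ y, pk ε (sl ε μ ψ) ψ x y * Real.exp (⟪y - bary ε μ ψ x, √ε • w⟫ / ε) ∂μ ≤ 2 := by
    intro w hw
    rw [pk_shift hε hR hψ]
    refine le_trans (Real.exp_le_exp.2 ?_) half
    have := hu x (x + √ε • w)
    rw [add_sub_cancel_left, norm_smul, hw, mul_one, Real.norm_of_nonneg hsq.le, sq, hsq2] at this
    rw [div_le_iff₀ hε]
    linarith
  have b1 := hb v hv
  have b2 := hb (-v) (by simpa using hv)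
  have hpt : ∀ s : ℝ, 2 + s ^ 2 / 2 ≤ Real.exp s + Real.exp (-s) := by
    intro s
    rcases le_total 0 s with hs | hs
    · have := Real.quadratic_le_exp_of_nonneg hs
      have := Real.add_one_le_exp (-s)
      linarith
    · have := Real.quadratic_le_exp_of_nonneg (neg_nonneg.2 hs)
      have := Real.add_one_le_exp s
      nlinarith
  have hsum : ∫ y, pk ε (sl ε μ ψ) ψ x y * (2 + ⟪v, y - bary ε μ ψ x⟫ ^ 2 * (1 / (2 * ε))) ∂μ
      ≤ 2 + 2 := by
    refine le_trans ?_ (add_le_add b1 b2)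
    rw [← integral_add (int_cont hR (by fun_prop)) (int_cont hR (by fun_prop))]
    refine integral_mono (int_cont hR (by fun_prop)) (int_cont hR (by fun_prop)) fun y => ?_
    dsimp only
    rw [← mul_add]
    refine mul_le_mul_of_nonneg_left ?_ (pk_pos _ _ _ _ _).le
    refine le_trans (le_of_eq ?_) ((hpt (⟪y - bary ε μ ψ x, √ε • v⟫ / ε)).trans (le_of_eq ?_))
    · rw [inner_smul_right, real_inner_comm]
      have : √ε ^ 2 = ε := by rw [sq, hsq2]
      rw [div_pow, mul_pow, this]
      field_simp
    · congr 2
      rw [smul_neg, inner_neg_right]; ring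
  have e : ∀ y, pk ε (sl ε μ ψ) ψ x y * (2 + ⟪v, y - bary ε μ ψ x⟫ ^ 2 * (1 / (2 * ε)))
      = pk ε (sl ε μ ψ) ψ x y * 2
        + (pk ε (sl ε μ ψ) ψ x y * ⟪v, y - bary ε μ ψ x⟫ ^ 2) * (1 / (2 * ε)) := by
    intro y; ring
  simp only [e] at hsum
  rw [integral_add (int_cont hR (by fun_prop)) (int_cont hR (by fun_prop)),
      integral_mul_const, integral_mul_const, pk_one hε hR hψ] at hsum
  have h5 : (∫ y, pk ε (sl ε μ ψ) ψ x y * ⟪v, y - bary ε μ ψ x⟫ ^ 2 ∂μ) * (1 / (2 * ε)) ≤ 2 := by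
    linarith
  rw [mul_one_div, div_le_iff₀ (by positivity)] at h5
  linarith

theorem var_tot (hε : 0 < ε) (hR : ∀ᵐ y ∂μ, ‖y‖ ≤ R) (hψ : Continuous ψ)
    (hu : ∀ x y, sl ε μ ψ y ≤ sl ε μ ψ x + ⟪bary ε μ ψ x, y - x⟫ + ‖y - x‖ ^ 2 / 2)
    (x : E) :
    ∫ y, pk ε (sl ε μ ψ) ψ x y * ‖y - bary ε μ ψ x‖ ^ 2 ∂μ ≤ Module.finrank ℝ E * (4 * ε) := by
  have hc := pk_cont_right (ε := ε) hψ (sl ε μ ψ) x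
  let b := stdOrthonormalBasis ℝ E
  have e : ∀ y, pk ε (sl ε μ ψ) ψ x y * ‖y - bary ε μ ψ x‖ ^ 2
      = ∑ i, pk ε (sl ε μ ψ) ψ x y * ⟪b i, y - bary ε μ ψ x⟫ ^ 2 := by
    intro y
    rw [← Finset.mul_sum, ← b.sum_sq_norm_inner_right]
    simp
  simp only [e]
  rw [integral_finsetSum _ fun i _ => int_cont hR (by fun_prop)]
  calc _ ≤ ∑ i : Fin (Module.finrank ℝ E), 4 * ε :=
        Finset.sum_le_sum fun i _ => var_dir hε hR hψ hu x (b i) (b.norm_eq_one i)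
    _ = _ := by simp

theorem bary_close (hε : 0 < ε) (hR : ∀ᵐ y ∂μ, ‖y‖ ≤ R) (hψ : Continuous ψ)
   
    (hu : ∀ x y, sl ε μ ψ y ≤ sl ε μ ψ x + ⟪bary ε μ ψ x, y - x⟫ + ‖y - x‖ ^ 2 / 2)
    {κ : ℝ} (hκ : 0 < κ) {h : E → ℝ} (hh : LipschitzWith 1 h) (x : E) :
    |∫ y, pk ε (sl ε μ ψ) ψ x y * h y ∂μ - h (bary ε μ ψ x)|
      ≤ κ / 2 + Module.finrank ℝ E * (4 * ε) / (2 * κ) := by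
  have hc := pk_cont_right (ε := ε) hψ (sl ε μ ψ) x
  have hhc := hh.continuous
  set m := bary ε μ ψ x with hm
  have e : ∫ y, pk ε (sl ε μ ψ) ψ x y * h y ∂μ - h m
      = ∫ y, pk ε (sl ε μ ψ) ψ x y * (h y - h m) ∂μ := by
    simp only [mul_sub]
    rw [integral_sub (int_cont hR (by fun_prop)) (int_cont hR (by fun_prop)),
      integral_mul_const, pk_one hε hR hψ, one_mul]
  rw [e]
  calc _ ≤ ∫ y, |pk ε (sl ε μ ψ) ψ x y * (h y - h m)| ∂μ := abs_integral_le_integral_abs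
    _ ≤ ∫ y, (pk ε (sl ε μ ψ) ψ x y * (κ / 2)
          + (pk ε (sl ε μ ψ) ψ x y * ‖y - m‖ ^ 2) * (1 / (2 * κ))) ∂μ := by
        refine integral_mono (int_cont hR (by fun_prop)) (int_cont hR (by fun_prop)) fun y => ?_
        dsimp only
        rw [abs_mul, abs_of_pos (pk_pos _ _ _ _ _), mul_assoc, ← mul_add]
        refine mul_le_mul_of_nonneg_left ?_ (pk_pos _ _ _ _ _).le
        have h1 := hh.dist_le_mul y m
        rw [Real.dist_eq, dist_eq_norm, NNReal.coe_one, one_mul] at h1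
        refine h1.trans ?_
        have h2 : 0 ≤ (‖y - m‖ - κ) ^ 2 / (2 * κ) := by positivity
        have h3 : (‖y - m‖ - κ) ^ 2 / (2 * κ)
            = κ / 2 + ‖y - m‖ ^ 2 * (1 / (2 * κ)) - ‖y - m‖ := by
          field_simp; ring
        linarith
    _ = κ / 2 + (∫ y, pk ε (sl ε μ ψ) ψ x y * ‖y - m‖ ^ 2 ∂μ) / (2 * κ) := by
        rw [integral_add (int_cont hR (by fun_prop)) (int_cont hR (by fun_prop)),
          integral_mul_const, integral_mul_const, pk_one hε hR hψ]
        ring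
    _ ≤ _ := by
        have := var_tot hε hR hψ hu x
        gcongr

end tilt

theorem pk_prod_integrable {ε : ℝ} {φ ψ : E → ℝ} (hφ : Continuous φ) (hψ : Continuous ψ)
    {ν μ : Measure E} [IsProbabilityMeasure ν] [IsProbabilityMeasure μ]
    (h1 : ∀ x, Integrable (fun y => pk ε φ ψ x y) μ) (h2 : ∀ x, ∫ y, pk ε φ ψ x y ∂μ = 1) :
    Integrable (fun z : E × E => pk ε φ ψ z.1 z.2) (ν.prod μ) := by
  rw [integrable_prod_iff (pk_cont hφ hψ).aestronglyMeasurable]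
  refine ⟨ae_of_all _ h1, ?_⟩
  have : ∀ x, ∫ y, ‖pk ε φ ψ x y‖ ∂μ = 1 := by
    intro x
    rw [← h2 x]
    congr 1; ext y
    exact Real.norm_of_nonneg (pk_pos _ _ _ _ _).le
  simp only [this]
  exact integrable_const 1

end Caff

end Part5

section Part6

set_option linter.unusedSectionVars false
namespace Caff
open Set Filter Topology
open scoped ENNReal NNReal RealInnerProductSpace

section fub
variable {E : Type*} [NormedAddCommGroup E] [InnerProductSpace ℝ E] [MeasurableSpace E]
  [BorelSpace E] [FiniteDimensional ℝ E]

theorem pk_fubini {ε : ℝ} {φ ψ h : E → ℝ} {ν μ : Measure E} [IsProbabilityMeasure ν]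
    [IsProbabilityMeasure μ]
    (hi : Integrable (fun z : E × E => pk ε φ ψ z.1 z.2) (ν.prod μ))
    (hh : Continuous h) (hb : ∀ x, |h x| ≤ 1) :
    ∫ x, ∫ y, pk ε φ ψ x y * h y ∂μ ∂ν = ∫ y, (∫ x, pk ε ψ φ y x ∂ν) * h y ∂μ ∧
    Integrable (fun x => ∫ y, pk ε φ ψ x y * h y ∂μ) ν ∧
    Integrable (fun y => (∫ x, pk ε ψ φ y x ∂ν) * h y) μ := by
  have hi2 : Integrable (Function.uncurry fun x y => pk ε φ ψ x y * h y) (ν.prod μ) := by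
    refine Integrable.mono hi ?_ (ae_of_all _ fun z => ?_)
    · exact hi.1.mul (by fun_prop : Continuous fun z : E × E => h z.2).aestronglyMeasurable
    · simp only [Function.uncurry]
      rw [norm_mul]
      have := hb z.2
      rw [← Real.norm_eq_abs] at this
      exact mul_le_of_le_one_right (norm_nonneg _) this
  have e : ∀ y, ∫ x, pk ε φ ψ x y * h y ∂ν = (∫ x, pk ε ψ φ y x ∂ν) * h y := by
    intro y
    rw [integral_mul_const]
    congr 1
    exact integral_congr_ae (ae_of_all _ fun x => pk_symm _ _ _ _ _)
  refine ⟨?_, hi2.integral_prod_left, ?_⟩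
  · rw [integral_integral_swap hi2]
    exact integral_congr_ae (ae_of_all _ e)
  · have := hi2.integral_prod_right
    simpa only [Function.uncurry, e] using this

end fub

theorem core {d : ℕ} {q U V : EuclideanSpace ℝ (Fin d) → ℝ}
    (hU : Continuous U) (hV : Continuous V)
    (hqa : ∀ z x y : EuclideanSpace ℝ (Fin d), ∀ a b : ℝ, a + b = 1 →
      q (z + (a • x + b • y)) - q (a • x + b • y) = a * (q (z + x) - q x) + b * (q (z + y) - q y))
    (hqV : ConvexOn ℝ univ fun x => q x - V x)
    (hUq : ConvexOn ℝ univ fun x => U x - q x) (R : ℝ≥0)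
    {ν μ : Measure (EuclideanSpace ℝ (Fin d))} [IsProbabilityMeasure ν] [IsProbabilityMeasure μ]
    (hν : ν = volume.withDensity fun x => ENNReal.ofReal (Real.exp (-V x)))
    (hμ : μ = (volume.restrict (Metric.closedBall 0 R)).withDensity
      fun x => ENNReal.ofReal (Real.exp (-U x)))
    (hmom : ∀ c : ℝ, Integrable (fun x => Real.exp (c * ‖x‖)) ν) {η : ℝ} (hη : 0 < η) :
    ∃ (φ : EuclideanSpace ℝ (Fin d) → ℝ) (g : EuclideanSpace ℝ (Fin d) → EuclideanSpace ℝ (Fin d)),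
      (∀ x y, 0 ≤ φ y - φ x - ⟪g x, y - x⟫ ∧ φ y - φ x - ⟪g x, y - x⟫ ≤ ‖y - x‖ ^ 2 / 2) ∧
      ∀ h : EuclideanSpace ℝ (Fin d) → ℝ, LipschitzWith 1 h → (∀ x, |h x| ≤ 1) →
        |∫ x, h x ∂μ - ∫ x, h (g x) ∂ν| ≤ η := by
  have hR : ∀ᵐ y ∂μ, ‖y‖ ≤ (R : ℝ) := by
    rw [hμ]
    refine (withDensity_absolutelyContinuous _ _).ae_le ?_
    filter_upwards [ae_restrict_mem Metric.isClosed_closedBall.measurableSet] with y hy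
    simpa using hy
  -- parameters
  set κ : ℝ := η / 4 with hκdef
  have hκ : 0 < κ := by positivity
  set ε : ℝ := κ ^ 2 / (4 * (d + 1)) with hεdef
  have hε : 0 < ε := by positivity
  set δ : ℝ := κ / (1 + 1 / κ) with hδdef
  have hδ : 0 < δ := by positivity
  set S : Set (EuclideanSpace ℝ (Fin d) → ℝ) :=
    {φ | LipschitzWith R φ ∧ ConvexOn ℝ univ fun x => ‖x‖ ^ 2 / 2 - φ x} with hS
  set J : (EuclideanSpace ℝ (Fin d) → ℝ) → ℝ := fun φ =>
    ∫ x, φ x ∂ν + ∫ y, sl ε ν φ y ∂μ with hJ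
  have hidint : Integrable (fun x : EuclideanSpace ℝ (Fin d) => x) ν := by
    refine Integrable.mono' (hmom 1) (by fun_prop) (ae_of_all _ fun x => ?_)
    have := Real.add_one_le_exp (1 * ‖x‖); linarith
  have slc : ∀ φ ∈ S, Continuous (sl ε ν φ) := fun φ hφ =>
    sl_cont hε hφ.1.continuous.measurable (SI_of_lip hε hmom hφ.1)
  have hbdd : BddBelow (J '' S) := by
    refine ⟨∫ y, ⟪∫ x, x ∂ν, y⟫ ∂μ, ?_⟩
    rintro _ ⟨φ, hφ, rfl⟩
    have hSI := SI_of_lip hε hmom hφ.1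
    have hpt : ∀ y, ⟪∫ x, x ∂ν, y⟫ - ∫ x, φ x ∂ν ≤ sl ε ν φ y := by
      intro y
      have hFi : Integrable (fun x => ⟪x, y⟫ - φ x) ν :=
        (hidint.inner_const y).sub (lip_int hmom hφ.1)
      have h1 := jensen_exp (hFi.div_const ε) (hSI y)
      rw [← exp_sl hε hSI, Real.exp_le_exp, integral_div,
        integral_sub (hidint.inner_const y) (lip_int hmom hφ.1)] at h1
      have h2 := (div_le_div_iff_of_pos_right hε).1 h1
      have h3 : ∫ x, ⟪x, y⟫ ∂ν = ⟪∫ x, x ∂ν, y⟫ := by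
        rw [real_inner_comm, ← integral_inner hidint]
        exact integral_congr_ae (ae_of_all _ fun x => real_inner_comm _ _)
      rwa [h3] at h2
    have h4 : ∫ y, (⟪∫ x, x ∂ν, y⟫ - ∫ x, φ x ∂ν) ∂μ ≤ ∫ y, sl ε ν φ y ∂μ :=
      integral_mono (int_cont hR (by fun_prop)) (int_cont hR (slc φ hφ)) hpt
    rw [integral_sub (int_cont hR (by fun_prop)) (integrable_const _)] at h4
    simp only [integral_const, probReal_univ, one_smul] at h4
    simp only [hJ]; linarith
  have hne : (J '' S).Nonempty := by
    refine ⟨J 0, 0, ⟨?_, ?_⟩, rfl⟩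
    · exact (LipschitzWith.const (0:ℝ)).weaken zero_le
    · refine convexOn_univ_of_pos fun x y a b ha hb hab => ?_
      have := norm_sq_affine a b hab x y
      have h2 : 0 ≤ a * b * ‖x - y‖ ^ 2 := by positivity
      simp only [Pi.zero_apply]; linarith
  obtain ⟨φ, hφ, hmin⟩ : ∃ φ ∈ S, ∀ φ' ∈ S, J φ ≤ J φ' + ε * δ := by
    obtain ⟨_, ⟨φ, hφ, rfl⟩, hlt⟩ := exists_lt_of_csInf_lt hne
      (lt_add_of_pos_right (sInf (J '' S)) (by positivity : 0 < ε * δ))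
    refine ⟨φ, hφ, fun φ' hφ' => ?_⟩
    have := csInf_le hbdd (mem_image_of_mem J hφ')
    linarith
  set ψ := sl ε ν φ with hψdef
  have hψ : Continuous ψ := slc φ hφ
  set φ' := sl ε μ ψ with hφ'def
  have hc : ConvexOn ℝ univ fun y => ψ y + ε * U y - ‖y‖ ^ 2 / 2 := by
    have h1 := source_step hε hV hφ.1.continuous hqa hqV hφ.2 hν (SI_of_lip hε hmom hφ.1)
    have h2 := h1.add (hUq.smul hε.le)
    refine h2.congr fun y _ => ?_
    simp only [Pi.add_apply, smul_eq_mul]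
    ring
  have hφ'c : ConvexOn ℝ univ fun x => ‖x‖ ^ 2 / 2 - φ' x :=
    target_step hε hU hψ Metric.isClosed_closedBall.measurableSet (convex_closedBall _ _) hc hμ
      (SI_of_bdd hR hψ)
  have hφ'S : φ' ∈ S := ⟨sl_lip hε hR hψ, hφ'c⟩
  set ψ' := sl ε ν φ' with hψ'def
  have hψ' : Continuous ψ' := slc φ' hφ'S
  have hφcont := hφ.1.continuous
  have hφ'cont := hφ'S.1.continuous
  have hSIφ := SI_of_lip hε hmom hφ.1
  have hSIφ' := SI_of_lip hε hmom hφ'S.1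
  have hSIψ : SI ε μ ψ := SI_of_bdd hR hψ
  -- first Fubini
  have hpi1 : Integrable (fun z : _ × _ => pk ε ψ φ z.1 z.2) (μ.prod ν) :=
    pk_prod_integrable hψ hφcont (pk_integrable hSIφ ψ) (fun y => by
      rw [pk_integral hε hSIφ]; simp [hψdef])
  have f1 := pk_fubini hpi1 (h := fun _ => 1) continuous_const (by simp)
  simp only [mul_one, pk_integral hε hSIφ, pk_integral hε hSIψ] at f1
  rw [← hψdef, ← hφ'def] at f1
  simp only [sub_self, zero_div, Real.exp_zero, integral_const, probReal_univ, one_smul] at f1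
  have hdec : ∫ x, (φ' x - φ x) ∂ν ≤ 0 := by
    have hi := (lip_int hmom hφ'S.1).sub (lip_int hmom hφ.1)
    have h1 := jensen_exp (hi.div_const ε) f1.2.2
    simp only [Pi.sub_apply] at h1
    rw [← f1.1, Real.exp_le_one_iff, integral_div] at h1
    by_contra hcon
    exact absurd h1 (not_le.2 (div_pos (not_le.1 hcon) hε))
  -- second Fubini
  have hpi2 : Integrable (fun z : _ × _ => pk ε φ' ψ z.1 z.2) (ν.prod μ) :=
    pk_prod_integrable hφ'cont hψ (pk_integrable hSIψ φ') (fun x => by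
      rw [pk_integral hε hSIψ]; simp [hφ'def])
  have f2 := pk_fubini hpi2 (h := fun _ => 1) continuous_const (by simp)
  simp only [mul_one, pk_integral hε hSIφ', pk_integral hε hSIψ] at f2
  rw [← hψ'def, ← hφ'def] at f2
  simp only [sub_self, zero_div, Real.exp_zero, integral_const, probReal_univ, one_smul] at f2
  have hw : - δ ≤ ∫ y, (ψ' y - ψ y) / ε ∂μ := by
    have h1 := hmin φ' hφ'S
    simp only [hJ] at h1
    rw [integral_sub (lip_int hmom hφ'S.1) (lip_int hmom hφ.1)] at hdec
    rw [integral_div, integral_sub (int_cont hR hψ') (int_cont hR hψ), le_div_iff₀ hε]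
    linarith
  have htv := tv_bound (int_cont hR (by fun_prop) : Integrable (fun y => (ψ' y - ψ y) / ε) μ)
    f2.2.2 f2.1.symm hw hκ
  have hδe : (1 + 1 / κ) * δ = κ := by rw [hδdef]; field_simp
  rw [hδe] at htv
  have hlow := sl_lower hε hR hψ
  have hupp := upper_of_semiconcave hφ'c hlow
  have hbounds : ∀ x y, 0 ≤ φ' y - φ' x - ⟪bary ε μ ψ x, y - x⟫ ∧
      φ' y - φ' x - ⟪bary ε μ ψ x, y - x⟫ ≤ ‖y - x‖ ^ 2 / 2 := fun x y =>
    ⟨by linarith [hlow x y], by linarith [hupp x y]⟩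
  refine ⟨φ', bary ε μ ψ, hbounds, fun h hh hb => ?_⟩
  have hg := (lip_of_bounds hbounds).continuous
  have hhc := hh.continuous
  have f3 := pk_fubini hpi2 hhc hb
  simp only [pk_integral hε hSIφ'] at f3
  rw [← hψ'def] at f3
  have hhμ : Integrable h μ := int_cont hR hhc
  have hhgν : Integrable (fun x => h (bary ε μ ψ x)) ν :=
    Integrable.mono' (integrable_const 1) (hhc.comp hg).aestronglyMeasurable
      (ae_of_all _ fun x => hb _)
  have p1 : |∫ y, Real.exp ((ψ' y - ψ y) / ε) * h y ∂μ - ∫ y, h y ∂μ| ≤ κ + κ := by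
    rw [← integral_sub f3.2.2 hhμ, ← Real.norm_eq_abs]
    refine le_trans (norm_integral_le_integral_norm _) (le_trans ?_ htv)
    refine integral_mono (f3.2.2.sub hhμ).norm (f2.2.2.sub (integrable_const 1)).norm fun y => ?_
    have : Real.exp ((ψ' y - ψ y) / ε) * h y - h y = (Real.exp ((ψ' y - ψ y) / ε) - 1) * h y := by
      ring
    simp only [Real.norm_eq_abs, this, abs_mul]
    exact mul_le_of_le_one_right (abs_nonneg _) (hb y)
  have p2 : |∫ x, ∫ y, pk ε φ' ψ x y * h y ∂μ ∂ν - ∫ x, h (bary ε μ ψ x) ∂ν| ≤ κ := by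
    rw [← integral_sub f3.2.1 hhgν, ← Real.norm_eq_abs]
    refine le_trans (norm_integral_le_of_norm_le_const (C := κ) (ae_of_all _ fun x => ?_)) (by simp)
    refine (bary_close hε hR hψ hupp hκ hh x).trans ?_
    rw [finrank_euclideanSpace_fin]
    have h1 : (d:ℝ) * (4 * ε) ≤ κ ^ 2 := by
      rw [hεdef]
      have : (d:ℝ) * (4 * (κ ^ 2 / (4 * (d + 1)))) = κ ^ 2 * (d / (d + 1)) := by field_simp
      rw [this]
      exact mul_le_of_le_one_right (by positivity) ((div_le_one (by positivity)).2 (by linarith))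
    have h2 : (d:ℝ) * (4 * ε) / (2 * κ) ≤ κ / 2 := by
      rw [div_le_iff₀ (by positivity)]; nlinarith
    linarith
  rw [f3.1] at p2
  rw [abs_le] at p1 p2 ⊢
  constructor <;> [linarith [p1.1, p1.2, p2.1, p2.2]; linarith [p1.1, p1.2, p2.1, p2.2]]

end Caff

end Part6

section Part7

set_option linter.unusedSectionVars false
namespace Caff
open Set Filter Topology
open scoped ENNReal NNReal RealInnerProductSpace

section rew
variable {E : Type*} [NormedAddCommGroup E] [MeasurableSpace E] [BorelSpace E]

theorem reweight {ρ ν : Measure E} [IsProbabilityMeasure ν] {K : Set E} (hK : MeasurableSet K)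
    {V p : E → ℝ} (hV : Measurable V) (hp : Measurable p) (hp0 : ∀ x, 0 ≤ p x)
    (hν : ν = ρ.withDensity fun x => ENNReal.ofReal (Real.exp (-V x)))
    {a : ℝ} (ha : a = ∫ x in K, Real.exp (-p x) ∂ν) (ha0 : 0 < a)
    {ν' : Measure E} (hν' : ν' = (ρ.restrict K).withDensity
      fun x => ENNReal.ofReal (Real.exp (-(V x + p x + Real.log a)))) :
    IsProbabilityMeasure ν' ∧
    (∀ h : E → ℝ, Measurable h → (∀ x, |h x| ≤ 1) →
      |∫ x, h x ∂ν' - ∫ x, h x ∂ν| ≤ 2 * (1 - a) / a) ∧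
    (∀ k : E → ℝ, Integrable (fun x => Real.exp (-p x) * k x) ν → Integrable k ν') := by
  have hres : ν.restrict K = (ρ.restrict K).withDensity
      fun x => ENNReal.ofReal (Real.exp (-V x)) := by
    rw [hν, restrict_withDensity hK]
  have hm : Measurable fun x => V x + p x + Real.log a := by fun_prop
  have e : ∀ (k : E → ℝ) x, Real.exp (-(V x + p x + Real.log a)) * k x
      = Real.exp (-V x) * (a⁻¹ * (Real.exp (-p x) * k x)) := by
    intro k x
    have : -(V x + p x + Real.log a) = -V x + -p x + -Real.log a := by ring
    rw [this, Real.exp_add, Real.exp_add, Real.exp_neg (Real.log a), Real.exp_log ha0]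
    ring
  have hInt : ∀ k : E → ℝ, ∫ x, k x ∂ν' = a⁻¹ * ∫ x in K, Real.exp (-p x) * k x ∂ν := by
    intro k
    rw [hν', integral_wd _ hm, hres, integral_wd _ hV, ← integral_const_mul]
    refine integral_congr_ae (ae_of_all _ fun x => ?_)
    simp only [e]; ring
  have hInt2 : ∀ k : E → ℝ, Integrable (fun x => Real.exp (-p x) * k x) ν → Integrable k ν' := by
    intro k hk
    rw [hν', integrable_wd _ hm]
    simp only [e]
    rw [← integrable_wd _ hV, ← hres]
    exact (hk.restrict).const_mul _
  have hw1 : ∀ x, Real.exp (-p x) ≤ 1 := fun x => Real.exp_le_one_iff.2 (by linarith [hp0 x])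
  have hwi : Integrable (fun x => Real.exp (-p x)) ν :=
    Integrable.mono' (integrable_const 1) (by fun_prop)
      (ae_of_all _ fun x => by rw [Real.norm_of_nonneg (Real.exp_pos _).le]; exact hw1 x)
  refine ⟨⟨?_⟩, ?_, hInt2⟩
  · have h1 : Integrable (fun _ : E => (1:ℝ)) ν' := hInt2 _ (by simpa using hwi)
    have h2 := hInt fun _ => 1
    simp only [mul_one] at h2
    rw [← ha, inv_mul_cancel₀ ha0.ne'] at h2
    have hfin : ν' univ < ⊤ := by
      rcases (integrable_const_iff.1 h1) with h | h
      · norm_num at h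
      · exact h.measure_univ_lt_top
    simp only [integral_const, smul_eq_mul, mul_one] at h2
    rw [← ENNReal.ofReal_toReal hfin.ne]
    change ENNReal.ofReal (ν'.real univ) = 1
    rw [h2]; simp
  · intro h hh hb
    set W : E → ℝ := K.indicator fun x => Real.exp (-p x) with hW
    have hWi : Integrable W ν := hwi.indicator hK
    have hWint : ∫ x, W x ∂ν = a := by rw [hW, integral_indicator hK, ha]
    have hW1 : ∀ x, W x ≤ 1 := fun x => by
      by_cases hx : x ∈ K
      · simp [hW, hx, hp0]
      · simp [hW, hx]
    have ha1 : a ≤ 1 := by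
      rw [← hWint]
      calc ∫ x, W x ∂ν ≤ ∫ x, (1:ℝ) ∂ν := integral_mono hWi (integrable_const _) hW1
        _ = 1 := by simp
    have hhi : Integrable h ν := Integrable.mono' (integrable_const 1) hh.aestronglyMeasurable
      (ae_of_all _ hb)
    have hWh : Integrable (fun x => W x * h x) ν := by
      refine Integrable.mono hWi (hWi.1.mul hh.aestronglyMeasurable) (ae_of_all _ fun x => ?_)
      rw [norm_mul]
      exact mul_le_of_le_one_right (norm_nonneg _) (hb x)
    have h1 : ∫ x, h x ∂ν' = ∫ x, a⁻¹ * (W x * h x) ∂ν := by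
      rw [hInt, integral_const_mul, ← integral_indicator hK]
      congr 1
      refine integral_congr_ae (ae_of_all _ fun x => ?_)
      by_cases hx : x ∈ K <;> simp [hW, hx]
    rw [h1, ← integral_sub (hWh.const_mul _) hhi, ← Real.norm_eq_abs]
    have h2 : ∫ x, a⁻¹ * ((1 - W x) + (1 - a)) ∂ν = 2 * (1 - a) / a := by
      have i1 : Integrable (fun x => 1 - W x) ν := (integrable_const _).sub hWi
      rw [integral_const_mul, integral_add i1 (integrable_const _),
        integral_sub (integrable_const _) hWi, hWint]
      simp; field_simp; ring
    rw [← h2]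
    refine norm_integral_le_of_norm_le ((((integrable_const _).sub hWi).add
      (integrable_const _)).const_mul _) (ae_of_all _ fun x => ?_)
    have h3 : a⁻¹ * (W x * h x) - h x = a⁻¹ * ((W x - a) * h x) := by field_simp
    rw [h3, Real.norm_eq_abs, abs_mul, abs_mul, abs_of_pos (inv_pos.2 ha0)]
    refine mul_le_mul_of_nonneg_left ?_ (inv_pos.2 ha0).le
    refine (mul_le_of_le_one_right (abs_nonneg _) (hb x)).trans ?_
    have := hW1 x
    rw [abs_le]; constructor <;> linarith

theorem mass_tendsto {ν : Measure E} [IsProbabilityMeasure ν] {K : ℕ → Set E}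
    (hK : ∀ k, MeasurableSet (K k)) (hKe : ∀ x, ∀ᶠ k in atTop, x ∈ K k)
    {p : E → ℝ} (hp : Measurable p) (hp0 : ∀ x, 0 ≤ p x) :
    Tendsto (fun k : ℕ => ∫ x in K k, Real.exp (-(1 / ((k:ℝ) + 1) * p x)) ∂ν) atTop (𝓝 1) := by
  have h1 : Tendsto (fun k : ℕ => ∫ x, (K k).indicator
      (fun x => Real.exp (-(1 / ((k:ℝ) + 1) * p x))) x ∂ν) atTop (𝓝 (∫ _, (1:ℝ) ∂ν)) := by
    refine tendsto_integral_of_dominated_convergence (fun _ => 1) (fun k => ?_)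
      (integrable_const _) (fun k => ae_of_all _ fun x => ?_) (ae_of_all _ fun x => ?_)
    · exact (Measurable.indicator (by fun_prop) (hK k)).aestronglyMeasurable
    · by_cases hx : x ∈ K k
      · have : 0 ≤ 1 / ((k:ℝ) + 1) * p x := mul_nonneg (by positivity) (hp0 x)
        simp only [hx, indicator_of_mem]
        rw [Real.norm_of_nonneg (Real.exp_pos _).le]
        exact Real.exp_le_one_iff.2 (by linarith)
      · simp [hx]
    · have h2 : Tendsto (fun k : ℕ => Real.exp (-(1 / ((k:ℝ) + 1) * p x))) atTop (𝓝 1) := by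
        have := (tendsto_one_div_add_atTop_nhds_zero_nat (𝕜 := ℝ)).mul_const (p x)
        have h3 := (Real.continuous_exp.tendsto _).comp this.neg
        simpa [Function.comp_def] using h3
      refine h2.congr' ?_
      filter_upwards [hKe x] with k hk
      simp [hk]
  simp only [integral_const, probReal_univ, one_smul] at h1
  refine h1.congr fun k => ?_
  rw [integral_indicator (hK k)]

end rew

theorem approx {d : ℕ} {q U V : EuclideanSpace ℝ (Fin d) → ℝ}
    (hU : Continuous U) (hV : Continuous V) (hq : Continuous q)
    (hqa : ∀ z x y : EuclideanSpace ℝ (Fin d), ∀ a b : ℝ, a + b = 1 →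
      q (z + (a • x + b • y)) - q (a • x + b • y) = a * (q (z + x) - q x) + b * (q (z + y) - q y))
    (hqV : ConvexOn ℝ univ fun x => q x - V x)
    (hUq : ConvexOn ℝ univ fun x => U x - q x)
    {c : ℝ} (hc : 0 < c) (hqc : ∀ x, c * ‖x‖ ^ 2 ≤ q x)
    {ν μ : Measure (EuclideanSpace ℝ (Fin d))} [IsProbabilityMeasure ν] [IsProbabilityMeasure μ]
    (hν : ν = volume.withDensity fun x => ENNReal.ofReal (Real.exp (-V x)))
    (hμ : μ = volume.withDensity fun x => ENNReal.ofReal (Real.exp (-U x)))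
    {η : ℝ} (hη : 0 < η) :
    ∃ (φ : EuclideanSpace ℝ (Fin d) → ℝ) (g : EuclideanSpace ℝ (Fin d) → EuclideanSpace ℝ (Fin d)),
      (∀ x y, 0 ≤ φ y - φ x - ⟪g x, y - x⟫ ∧ φ y - φ x - ⟪g x, y - x⟫ ≤ ‖y - x‖ ^ 2 / 2) ∧
      ∀ h : EuclideanSpace ℝ (Fin d) → ℝ, LipschitzWith 1 h → (∀ x, |h x| ≤ 1) →
        |∫ x, h x ∂μ - ∫ x, h (g x) ∂ν| ≤ η := by
  have hq0 : ∀ x, 0 ≤ q x := fun x => le_trans (by positivity) (hqc x)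
  have tν := mass_tendsto (ν := ν) (K := fun _ => univ) (fun _ => MeasurableSet.univ)
    (fun _ => by simp) hq.measurable hq0
  have tμ := mass_tendsto (ν := μ) (K := fun k : ℕ => Metric.closedBall 0 (((k:ℝ≥0) : ℝ)))
    (fun _ => Metric.isClosed_closedBall.measurableSet)
    (fun x => by
      obtain ⟨n, hn⟩ := exists_nat_ge ‖x‖
      filter_upwards [eventually_ge_atTop n] with k hk
      have : (n:ℝ) ≤ k := by exact_mod_cast hk
      simp; linarith) hq.measurable hq0
  have lim : ∀ u : ℕ → ℝ, Tendsto u atTop (𝓝 1) →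
      ∀ᶠ k in atTop, 0 < u k ∧ 2 * (1 - u k) / u k ≤ η / 3 := by
    intro u hu
    have h1 : Tendsto (fun k => 2 * (1 - u k) / u k) atTop (𝓝 (2 * (1 - 1) / 1)) :=
      ((hu.const_sub 1).const_mul 2).div hu one_ne_zero
    have h2 := h1.eventually_le_const (u := η / 3) (by norm_num; exact hη)
    filter_upwards [h2, hu.eventually_const_lt zero_lt_one] with k h3 h4 using ⟨h4, h3⟩
  obtain ⟨k, ⟨ha0, ha⟩, ⟨hb0, hb⟩⟩ := ((lim _ tν).and (lim _ tμ)).exists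
  set δ : ℝ := 1 / ((k:ℝ) + 1) with hδ
  have hδ0 : 0 < δ := by positivity
  obtain ⟨a, hadef⟩ : ∃ a, a = ∫ x in univ, Real.exp (-(δ * q x)) ∂ν := ⟨_, rfl⟩
  obtain ⟨b, hbdef⟩ : ∃ b, b = ∫ x in Metric.closedBall 0 (((k:ℝ≥0) : ℝ)),
    Real.exp (-(δ * q x)) ∂μ := ⟨_, rfl⟩
  rw [← hadef] at ha0 ha
  rw [← hbdef] at hb0 hb
  obtain ⟨ν', hν'⟩ : ∃ ν' : Measure (EuclideanSpace ℝ (Fin d)), ν' = (volume.restrict univ).withDensity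
    fun x => ENNReal.ofReal (Real.exp (-(V x + δ * q x + Real.log a))) := ⟨_, rfl⟩
  obtain ⟨μ', hμ'⟩ : ∃ μ' : Measure (EuclideanSpace ℝ (Fin d)), μ' =
    (volume.restrict (Metric.closedBall 0 (((k:ℝ≥0) : ℝ)))).withDensity
    fun x => ENNReal.ofReal (Real.exp (-(U x + δ * q x + Real.log b))) := ⟨_, rfl⟩
  have hpm : Measurable fun x => δ * q x := by have := hq.measurable; fun_prop
  have hp0 : ∀ x, 0 ≤ δ * q x := fun x => mul_nonneg hδ0.le (hq0 x)
  obtain ⟨iν, dν, mν⟩ := reweight MeasurableSet.univ hV.measurable hpm hp0 hν hadef ha0 hν'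
  obtain ⟨iμ, dμ, -⟩ := reweight Metric.isClosed_closedBall.measurableSet hU.measurable hpm hp0
    hμ hbdef hb0 hμ'
  rw [Measure.restrict_univ] at hν'
  have hmom : ∀ t : ℝ, Integrable (fun x => Real.exp (t * ‖x‖)) ν' := by
    intro t
    apply mν
    refine Integrable.mono' (integrable_const (Real.exp (t ^ 2 / (4 * (δ * c))))) ?_
      (ae_of_all _ fun x => ?_)
    · exact Continuous.aestronglyMeasurable (by fun_prop)
    · rw [← Real.exp_add, Real.norm_of_nonneg (Real.exp_pos _).le, Real.exp_le_exp,
        le_div_iff₀ (by positivity)]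
      have h1 := mul_le_mul_of_nonneg_left (hqc x) hδ0.le
      have h2 : 0 < δ * c := by positivity
      nlinarith [sq_nonneg (t - 2 * (δ * c) * ‖x‖)]
  obtain ⟨φ, g, h1, h2⟩ := core (q := fun x => (1 + δ) * q x)
    (U := fun x => U x + δ * q x + Real.log b) (V := fun x => V x + δ * q x + Real.log a)
    (by fun_prop) (by fun_prop) (fun z x y a b hab => by
      have := hqa z x y a b hab
      linear_combination (1 + δ) * this)
    ((hqV.add (convexOn_const (-Real.log a) convex_univ)).congr fun x _ => by
      simp only [Pi.add_apply]; ring)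
    ((hUq.add (convexOn_const (Real.log b) convex_univ)).congr fun x _ => by
      simp only [Pi.add_apply]; ring) (k : ℝ≥0) hν' hμ' hmom (η := η / 3) (by positivity)
  refine ⟨φ, g, h1, fun h hh hhb => ?_⟩
  have hgc := (lip_of_bounds h1).continuous
  have a1 := dν (fun x => h (g x)) (hh.continuous.comp hgc).measurable (fun x => hhb _)
  have a2 := dμ h hh.continuous.measurable hhb
  have a3 := h2 h hh hhb
  rw [abs_le] at a1 a2 a3 ⊢
  constructor <;> linarith [a1.1, a1.2, a2.1, a2.2, a3.1, a3.2]

end Caff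

end Part7

section Part8

set_option linter.unusedSectionVars false
namespace Caff
open Set Filter Topology
open scoped ENNReal NNReal RealInnerProductSpace

variable {E : Type*} [NormedAddCommGroup E] [InnerProductSpace ℝ E] [MeasurableSpace E]
  [BorelSpace E] [FiniteDimensional ℝ E]

theorem ext_of_lip {μ ρ : Measure E} [IsProbabilityMeasure μ] [IsProbabilityMeasure ρ]
    (H : ∀ h : E → ℝ, LipschitzWith 1 h → (∀ x, |h x| ≤ 1) → ∫ x, h x ∂μ = ∫ x, h x ∂ρ) :
    μ = ρ := by
  refine ext_of_generate_finite _ ?_ isPiSystem_isClosed (fun F hF => ?_) (by simp)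
  · rw [BorelSpace.measurable_eq (α := E), borel_eq_generateFrom_isClosed]
  have hF' : IsClosed F := hF
  have pos : ∀ n : ℕ, 0 < 1 / ((n:ℝ) + 1) := fun n => by positivity
  have t1 := tendsto_integral_thickenedIndicator_of_isClosed μ hF' pos
    tendsto_one_div_add_atTop_nhds_zero_nat
  have t2 := tendsto_integral_thickenedIndicator_of_isClosed ρ hF' pos
    tendsto_one_div_add_atTop_nhds_zero_nat
  have e : ∀ n, ∫ ω, (thickenedIndicator (pos n) F ω : ℝ) ∂μ
      = ∫ ω, (thickenedIndicator (pos n) F ω : ℝ) ∂ρ := by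
    intro n
    have hl := lipschitzWith_thickenedIndicator (pos n) F
    set L : ℝ≥0 := (1 / ((n:ℝ) + 1)).toNNReal⁻¹
    have h0 := H (fun x => (L + 1 : ℝ)⁻¹ * (thickenedIndicator (pos n) F x : ℝ)) ?_ ?_
    · rw [integral_const_mul, integral_const_mul] at h0
      exact mul_left_cancel₀ (by positivity) h0
    · refine LipschitzWith.of_dist_le_mul fun x y => ?_
      have h1 := hl.dist_le_mul x y
      rw [NNReal.dist_eq] at h1
      rw [Real.dist_eq, ← mul_sub, abs_mul, abs_of_pos (by positivity), inv_mul_le_iff₀ (by positivity)]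
      have : 0 ≤ dist x y := dist_nonneg
      push_cast; nlinarith
    · intro x
      have h1 : (thickenedIndicator (pos n) F x : ℝ) ≤ 1 := thickenedIndicator_le_one _ _ _
      have hL : (0:ℝ) ≤ L := L.2
      rw [abs_of_nonneg (by positivity), inv_mul_le_iff₀ (by positivity)]
      linarith
  simp only [e] at t1
  have := tendsto_nhds_unique t1 t2
  rwa [measureReal_eq_measureReal_iff] at this

/-- Radial cutoff. -/
noncomputable def cut (R : ℝ) (y : E) : ℝ := max 0 (min 1 (R + 1 - ‖y‖))

theorem cut_lip (R : ℝ) : LipschitzWith 1 (cut (E := E) R) := by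
  unfold cut
  refine LipschitzWith.const_max (LipschitzWith.const_min ?_ _) _
  refine LipschitzWith.of_dist_le_mul fun x y => ?_
  rw [Real.dist_eq, dist_eq_norm]
  have := abs_norm_sub_norm_le y x
  rw [norm_sub_rev y x] at this
  simp only [NNReal.coe_one, one_mul]
  calc _ = |‖y‖ - ‖x‖| := by congr 1; ring
    _ ≤ _ := this

theorem cut_nonneg (R : ℝ) (y : E) : 0 ≤ cut R y := le_max_left _ _
theorem cut_le (R : ℝ) (y : E) : cut R y ≤ 1 := max_le zero_le_one (min_le_left _ _)
theorem cut_abs (R : ℝ) (y : E) : |cut R y| ≤ 1 := by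
  rw [abs_of_nonneg (cut_nonneg R y)]; exact cut_le R y
theorem cut_zero {R : ℝ} {y : E} (h : R + 1 ≤ ‖y‖) : cut R y = 0 := by
  unfold cut
  rw [max_eq_left]
  exact (min_le_right _ _).trans (by linarith)
theorem cut_one {R : ℝ} {y : E} (h : ‖y‖ ≤ R) : cut R y = 1 := by
  unfold cut
  rw [min_eq_left (by linarith), max_eq_right zero_le_one]

theorem cut_tight (μ : Measure E) [IsProbabilityMeasure μ] : ∃ R : ℝ, 3 / 4 ≤ ∫ x, cut R x ∂μ := by
  have h1 : Tendsto (fun k : ℕ => ∫ x, cut (k:ℝ) x ∂μ) atTop (𝓝 (∫ _, (1:ℝ) ∂μ)) := by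
    refine tendsto_integral_of_dominated_convergence (fun _ => 1)
      (fun k => (cut_lip _).continuous.aestronglyMeasurable)
      (integrable_const _) (fun k => ae_of_all _ fun x => cut_abs _ _) (ae_of_all _ fun x => ?_)
    obtain ⟨n, hn⟩ := exists_nat_ge ‖x‖
    refine tendsto_const_nhds.congr' ?_
    filter_upwards [eventually_ge_atTop n] with k hk
    have : (n:ℝ) ≤ k := by exact_mod_cast hk
    rw [cut_one (by linarith)]
  simp only [integral_const, probReal_univ, one_smul] at h1
  obtain ⟨k, hk⟩ := (h1.eventually_const_le (u := 3 / 4) (by norm_num)).exists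
  exact ⟨k, hk⟩

theorem lip_subseq {M : ℝ} {g : ℕ → E → E} (hg : ∀ k, LipschitzWith 1 (g k))
    (h0 : ∀ k, ‖g k 0‖ ≤ M) :
    ∃ (G : E → E) (s : ℕ → ℕ), StrictMono s ∧ ∀ x, Tendsto (fun k => g (s k) x) atTop (𝓝 (G x)) := by
  let S : Set C(E, E) := {f | LipschitzWith 1 f ∧ ‖f 0‖ ≤ M}
  have hS : IsCompact S := by
    refine ArzelaAscoli.isCompact_of_equicontinuous S ?_ ?_
    · have e : ContinuousMap.toFun '' S = {f : E → E | LipschitzWith 1 f} ∩ {f | ‖f 0‖ ≤ M} := by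
        ext f; constructor
        · rintro ⟨F, hF, rfl⟩; exact hF
        · intro hf; exact ⟨⟨f, hf.1.continuous⟩, hf, rfl⟩
      rw [e]
      refine IsCompact.of_isClosed_subset
        (isCompact_univ_pi fun x : E => isCompact_closedBall (0:E) (M + ‖x‖)) ?_ ?_
      · exact (isClosed_setOfPred_lipschitzWith 1).inter
          (isClosed_le (by fun_prop) continuous_const)
      · intro f hf x _
        have h1 := hf.1.dist_le_mul x 0
        have h2 : ‖f 0‖ ≤ M := hf.2
        rw [dist_eq_norm, dist_eq_norm, sub_zero] at h1
        simp only [NNReal.coe_one, one_mul] at h1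
        rw [mem_closedBall_zero_iff]
        have := norm_le_norm_add_norm_sub' (f x) (f 0)
        linarith
    · exact (LipschitzWith.uniformEquicontinuous _ 1 fun f => f.2.1).equicontinuous
  obtain ⟨G, -, s, hs, hG⟩ := hS.tendsto_subseq (x := fun k => (⟨g k, (hg k).continuous⟩ : C(E, E)))
    (fun k => ⟨hg k, h0 k⟩)
  refine ⟨G, s, hs, fun x => ?_⟩
  exact ((ContinuousEvalConst.continuous_eval_const x).tendsto G).comp hG

theorem limit {ν μ : Measure E} [IsProbabilityMeasure ν] [IsProbabilityMeasure μ]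
    (H : ∀ η : ℝ, 0 < η → ∃ (φ : E → ℝ) (g : E → E),
      (∀ x y, 0 ≤ φ y - φ x - ⟪g x, y - x⟫ ∧ φ y - φ x - ⟪g x, y - x⟫ ≤ ‖y - x‖ ^ 2 / 2) ∧
      ∀ h : E → ℝ, LipschitzWith 1 h → (∀ x, |h x| ≤ 1) →
        |∫ x, h x ∂μ - ∫ x, h (g x) ∂ν| ≤ η) :
    ∃ (φ : E → ℝ) (g : E → E),
      (∀ x y, 0 ≤ φ y - φ x - ⟪g x, y - x⟫ ∧ φ y - φ x - ⟪g x, y - x⟫ ≤ ‖y - x‖ ^ 2 / 2) ∧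
      ν.map g = μ := by
  choose φ g hb hi using fun k : ℕ => H (1 / ((k:ℝ) + 1) * (1 / 4)) (by positivity)
  have hl : ∀ k, LipschitzWith 1 (g k) := fun k => lip_of_bounds (hb k)
  obtain ⟨R, hR⟩ := cut_tight μ
  obtain ⟨r, hr⟩ := cut_tight ν
  have h0 : ∀ k, ‖g k 0‖ ≤ R + 1 + (r + 1) := by
    intro k
    by_contra hcon
    push Not at hcon
    have h1 := (abs_le.1 (hi k _ (cut_lip R) (cut_abs R))).2
    have h2 : 1 / ((k:ℝ) + 1) ≤ 1 := (div_le_one (by positivity)).2 (by linarith [k.cast_nonneg (α := ℝ)])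
    have i1 : Integrable (fun x => cut R (g k x)) ν :=
      Integrable.mono' (integrable_const 1)
        ((cut_lip R).continuous.comp (hl k).continuous).aestronglyMeasurable
        (ae_of_all _ fun x => cut_abs _ _)
    have i2 : Integrable (fun x => cut r x) ν :=
      Integrable.mono' (integrable_const 1)
        (cut_lip r).continuous.aestronglyMeasurable
        (ae_of_all _ fun x => cut_abs _ _)
    have h3 : ∫ x, (cut R (g k x) + cut r x) ∂ν ≤ ∫ _, (1:ℝ) ∂ν := by
      refine integral_mono (i1.add i2) (integrable_const _) fun x => ?_
      simp only
      rcases le_total (r + 1) ‖x‖ with hx | hx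
      · rw [cut_zero hx, add_zero]; exact cut_le _ _
      · have h4 := (hl k).dist_le_mul 0 x
        rw [dist_eq_norm, dist_eq_norm, zero_sub, norm_neg] at h4
        simp only [NNReal.coe_one, one_mul] at h4
        have h5 := norm_le_norm_add_norm_sub' (g k 0) (g k x)
        rw [cut_zero (by linarith : R + 1 ≤ ‖g k x‖), zero_add]; exact cut_le _ _
    rw [integral_add i1 i2] at h3
    simp only [integral_const, probReal_univ, one_smul] at h3
    linarith
  obtain ⟨G, s, hs, hG⟩ := lip_subseq hl h0
  -- limit of potentials along an ultrafilter
  set u : Filter ℕ := (hyperfilter ℕ : Filter ℕ) with hu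
  have hule : u ≤ atTop := by rw [← Nat.cofinite_eq_atTop]; exact hyperfilter_le_cofinite
  have hΦ : ∀ y, ∃ L : ℝ, Tendsto (fun k => φ (s k) y - φ (s k) 0) u (𝓝 L) := by
    intro y
    set B := (R + 1 + (r + 1)) * ‖y‖ + ‖y‖ ^ 2 / 2
    have hmem : ∀ k, φ (s k) y - φ (s k) 0 ∈ Icc (-B) B := by
      intro k
      have h1 := hb (s k) 0 y
      rw [sub_zero] at h1
      have h2 := abs_le.1 ((abs_real_inner_le_norm (g (s k) 0) y).trans
        (mul_le_mul_of_nonneg_right (h0 (s k)) (norm_nonneg y)))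
      have : 0 ≤ ‖y‖ ^ 2 / 2 := by positivity
      constructor <;> simp only [B] <;> linarith [h1.1, h1.2, h2.1, h2.2]
    obtain ⟨L, -, hL⟩ := (isCompact_Icc (a := -B) (b := B)).ultrafilter_le_nhds
      ((hyperfilter ℕ).map fun k => φ (s k) y - φ (s k) 0)
      (by
        rw [le_principal_iff]
        exact Filter.mem_map.2 (Filter.univ_mem' hmem))
    exact ⟨L, hL⟩
  choose Φ hΦ using hΦ
  have hbnd : ∀ x y, 0 ≤ Φ y - Φ x - ⟪G x, y - x⟫ ∧ Φ y - Φ x - ⟪G x, y - x⟫ ≤ ‖y - x‖ ^ 2 / 2 := by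
    intro x y
    have t : Tendsto (fun k => (φ (s k) y - φ (s k) 0) - (φ (s k) x - φ (s k) 0)
        - ⟪g (s k) x, y - x⟫) u (𝓝 (Φ y - Φ x - ⟪G x, y - x⟫)) :=
      ((hΦ y).sub (hΦ x)).sub (((hG x).mono_left hule).inner tendsto_const_nhds)
    constructor
    · refine ge_of_tendsto' t fun k => ?_
      linarith [(hb (s k) x y).1]
    · refine le_of_tendsto' t fun k => ?_
      linarith [(hb (s k) x y).2]
  have hGc := (lip_of_bounds hbnd).continuous
  refine ⟨Φ, G, hbnd, ?_⟩
  have : IsProbabilityMeasure (ν.map G) := Measure.isProbabilityMeasure_map hGc.aemeasurable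
  refine ext_of_lip fun h hh hhb => ?_
  rw [integral_map hGc.aemeasurable hh.continuous.aestronglyMeasurable]
  have t1 : Tendsto (fun k => ∫ x, h (g (s k) x) ∂ν) atTop (𝓝 (∫ x, h (G x) ∂ν)) := by
    refine tendsto_integral_of_dominated_convergence (fun _ => 1)
      (fun k => (hh.continuous.comp (hl _).continuous).aestronglyMeasurable)
      (integrable_const _) (fun k => ae_of_all _ fun x => hhb _) (ae_of_all _ fun x => ?_)
    exact (hh.continuous.tendsto _).comp (hG x)
  have t2 : Tendsto (fun k => ∫ x, h (g k x) ∂ν) atTop (𝓝 (∫ x, h x ∂μ)) := by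
    rw [tendsto_iff_dist_tendsto_zero]
    have t3 : Tendsto (fun k : ℕ => 1 / ((k:ℝ) + 1) * (1 / 4)) atTop (𝓝 0) := by
      have t4 := (tendsto_one_div_add_atTop_nhds_zero_nat (𝕜 := ℝ)).mul_const (1 / 4); rwa [zero_mul] at t4
    refine squeeze_zero (fun _ => dist_nonneg) (fun k => ?_) t3
    rw [dist_comm, Real.dist_eq]
    exact hi k h hh hhb
  exact tendsto_nhds_unique t1 (t2.comp hs.tendsto_atTop)

theorem finish {φ : E → ℝ} {g : E → E}
    (hb : ∀ x y, 0 ≤ φ y - φ x - ⟪g x, y - x⟫ ∧ φ y - φ x - ⟪g x, y - x⟫ ≤ ‖y - x‖ ^ 2 / 2) :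
    ConvexOn ℝ univ φ ∧ Differentiable ℝ φ ∧ gradient φ = g := by
  have hgrad : ∀ x, HasGradientAt φ (g x) x := by
    intro x
    rw [hasGradientAt_iff_isLittleO]
    refine Asymptotics.IsBigO.trans_isLittleO (g := fun y => ‖y - x‖ ^ 2) ?_ ?_
    · refine Asymptotics.IsBigO.of_bound 1 (Eventually.of_forall fun y => ?_)
      have := hb x y
      rw [Real.norm_of_nonneg this.1, Real.norm_of_nonneg (by positivity)]
      nlinarith [sq_nonneg ‖y - x‖]
    · exact Asymptotics.isLittleO_pow_sub_sub x one_lt_two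
  refine ⟨?_, fun x => (hgrad x).differentiableAt, funext fun x => (hgrad x).gradient⟩
  refine convexOn_univ_of_pos fun x y a b ha hb' hab => ?_
  set z := a • x + b • y with hz
  have h1 := (hb z x).1
  have h2 := (hb z y).1
  have h3 : a * ⟪g z, x - z⟫ + b * ⟪g z, y - z⟫ = 0 := by
    rw [← inner_smul_right, ← inner_smul_right, ← inner_add_right]
    have : a • (x - z) + b • (y - z) = 0 := by
      rw [smul_sub, smul_sub]
      have : a • z + b • z = z := by rw [← add_smul, hab, one_smul]
      calc _ = a • x + b • y - (a • z + b • z) := by abel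
        _ = 0 := by rw [this, hz, sub_self]
    rw [this, inner_zero_right]
  have h4 := mul_nonneg ha.le h1
  have h5 := mul_nonneg hb'.le h2
  have h6 : φ z = a * φ z + b * φ z := by rw [← add_mul, hab, one_mul]
  nlinarith

end Caff

end Part8

section Part9

set_option linter.unusedSectionVars false
namespace Caff
open Set Filter Topology
open scoped ENNReal NNReal RealInnerProductSpace

variable {E : Type*} [NormedAddCommGroup E] [InnerProductSpace ℝ E] [MeasurableSpace E]
  [BorelSpace E] [FiniteDimensional ℝ E]

theorem line_convex {f : E → ℝ} (hf : ContDiff ℝ 2 f) {v : E} {m : ℝ}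
    (h : ∀ x, m ≤ iteratedFDeriv ℝ 2 f x ![v, v]) (x : E) :
    ConvexOn ℝ univ fun t : ℝ => f (x + t • v) - m * t ^ 2 / 2 := by
  have hd : Differentiable ℝ f := hf.differentiable (by norm_num)
  have hd2 : Differentiable ℝ (fderiv ℝ f) :=
    (hf.fderiv_right (m := 1) (by norm_num)).differentiable (by norm_num)
  have hl : ∀ t : ℝ, HasDerivAt (fun t : ℝ => x + t • v) v t := fun t => by
    simpa using ((hasDerivAt_id t).smul_const v).const_add x
  have d1 : ∀ t : ℝ, HasDerivAt (fun t : ℝ => f (x + t • v) - m * t ^ 2 / 2)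
      (fderiv ℝ f (x + t • v) v - m * t) t := by
    intro t
    have h1 := (hd (x + t • v)).hasFDerivAt.comp_hasDerivAt t (hl t)
    have h2 : HasDerivAt (fun t : ℝ => m * t ^ 2 / 2) (m * t) t := by
      have h3 := (((hasDerivAt_id' t).pow 2).const_mul m).div_const 2
      have e : m * (((2:ℕ):ℝ) * t ^ (2 - 1) * 1) / 2 = m * t := by norm_num; ring
      rw [e] at h3
      exact h3
    exact h1.sub h2
  have d2 : ∀ t : ℝ, HasDerivAt (fun t : ℝ => fderiv ℝ f (x + t • v) v - m * t)
      (fderiv ℝ (fderiv ℝ f) (x + t • v) v v - m) t := by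
    intro t
    have h1 := (hd2 (x + t • v)).hasFDerivAt.comp_hasDerivAt t (hl t)
    have h3 := h1.clm_apply (hasDerivAt_const t v)
    have h2 : HasDerivAt (fun t : ℝ => m * t) m t := by
      simpa using (hasDerivAt_id t).const_mul m
    have h4 := h3.sub h2
    rw [map_zero, add_zero] at h4
    exact h4
  refine convexOn_of_hasDerivWithinAt2_nonneg convex_univ
    (fun t _ => (d1 t).continuousAt.continuousWithinAt)
    (fun t _ => (d1 t).hasDerivWithinAt) (fun t _ => (d2 t).hasDerivWithinAt) fun t _ => ?_
  have := h (x + t • v)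
  rw [iteratedFDeriv_two_apply] at this
  simp at this
  linarith

theorem convex_of_lines {F : E → ℝ}
    (h : ∀ x v, ConvexOn ℝ univ fun t : ℝ => F (x + t • v)) : ConvexOn ℝ univ F := by
  refine convexOn_univ_of_pos fun x y a b ha hb hab => ?_
  have h1 := (h x (y - x)).2 (mem_univ 0) (mem_univ 1) ha.le hb.le hab
  simp only [smul_eq_mul, mul_zero, mul_one, zero_add, zero_smul, add_zero, one_smul,
    add_sub_cancel] at h1
  have e : x + b • (y - x) = a • x + b • y := by
    obtain rfl : a = 1 - b := by linarith
    rw [smul_sub, sub_smul, one_smul]; abel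
  rwa [e] at h1

theorem affine_convex (c k : ℝ) : ConvexOn ℝ univ fun t : ℝ => c + t * k := by
  refine ⟨convex_univ, fun x _ y _ a b _ _ hab => le_of_eq ?_⟩
  simp only [smul_eq_mul]
  linear_combination (-c) * hab

theorem quad_form {d : ℕ} (A : Matrix (Fin d) (Fin d) ℝ) (v w : EuclideanSpace ℝ (Fin d)) :
    ⟪v, Matrix.toEuclideanCLM (𝕜 := ℝ) A w⟫ = ∑ i, ∑ j, A i j * v i * w j := by
  simp only [PiLp.inner_apply, Matrix.ofLp_toEuclideanCLM, Matrix.mulVec, dotProduct]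
  refine Finset.sum_congr rfl fun i _ => ?_
  simp only [RCLike.inner_apply, conj_trivial, Finset.sum_mul]
  exact Finset.sum_congr rfl fun j _ => by ring

theorem main {d : ℕ} (U V : EuclideanSpace ℝ (Fin d) → ℝ) (hU : ContDiff ℝ 2 U)
    (hV : ContDiff ℝ 2 V) (μ ν : Measure (EuclideanSpace ℝ (Fin d)))
    (hμ : μ = volume.withDensity fun x => ENNReal.ofReal (Real.exp (-U x)))
    (hν : ν = volume.withDensity fun x => ENNReal.ofReal (Real.exp (-V x)))
    [IsProbabilityMeasure μ] [IsProbabilityMeasure ν]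
    (A : Matrix (Fin d) (Fin d) ℝ) (hA : A.PosDef)
    (hUV : ∀ x v, iteratedFDeriv ℝ 2 V x ![v, v] ≤ ∑ i, ∑ j, A i j * v i * v j ∧
      ∑ i, ∑ j, A i j * v i * v j ≤ iteratedFDeriv ℝ 2 U x ![v, v]) :
    ∃ φ : EuclideanSpace ℝ (Fin d) → ℝ, ConvexOn ℝ Set.univ φ ∧ Differentiable ℝ φ ∧
      LipschitzWith 1 (gradient φ) ∧ ν.map (gradient φ) = μ := by
  set T := Matrix.toEuclideanCLM (𝕜 := ℝ) A with hT
  have hsymm : ∀ v w, ⟪v, T w⟫ = ⟪w, T v⟫ := by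
    intro v w
    rw [quad_form, quad_form, Finset.sum_comm]
    refine Finset.sum_congr rfl fun i _ => Finset.sum_congr rfl fun j _ => ?_
    have := hA.isHermitian.apply i j
    simp only [star_trivial] at this
    rw [this]; ring
  have hpos : ∀ v, v ≠ 0 → 0 < ⟪v, T v⟫ := by
    intro v hv
    have hv' : v.ofLp ≠ 0 := by simpa using hv
    have := hA.dotProduct_mulVec_pos hv'
    rw [quad_form]
    simp only [dotProduct, Matrix.mulVec, Pi.star_apply, star_trivial, Finset.mul_sum] at this
    refine this.trans_eq (Finset.sum_congr rfl fun i _ => Finset.sum_congr rfl fun j _ => ?_)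
    ring
  set q : EuclideanSpace ℝ (Fin d) → ℝ := fun x => ⟪x, T x⟫ / 2 with hq
  have hqadd : ∀ z w, q (z + w) = q z + q w + ⟪z, T w⟫ := by
    intro z w
    simp only [hq, map_add, inner_add_left, inner_add_right, hsymm w z]; ring
  have hqsmul : ∀ (t : ℝ) z, q (t • z) = t ^ 2 * q z := by
    intro t z
    simp only [hq, map_smul, inner_smul_left, inner_smul_right, conj_trivial]; ring
  have hqc : Continuous q := by simp only [hq]; fun_prop
  have hqline : ∀ x v (t : ℝ), q (x + t • v) = q x + t * ⟪x, T v⟫ + ⟪v, T v⟫ * t ^ 2 / 2 := by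
    intro x v t
    rw [hqadd, hqsmul, map_smul, inner_smul_right]; simp only [hq]; ring
  have hqa : ∀ z x y : EuclideanSpace ℝ (Fin d), ∀ a b : ℝ, a + b = 1 →
      q (z + (a • x + b • y)) - q (a • x + b • y)
        = a * (q (z + x) - q x) + b * (q (z + y) - q y) := by
    intro z x y a b hab
    rw [hqadd z, hqadd z x, hqadd z y, map_add, map_smul, map_smul, inner_add_right,
      inner_smul_right, inner_smul_right]
    linear_combination (-q z) * hab
  have hUq : ConvexOn ℝ univ fun x => U x - q x := by
    refine convex_of_lines fun x v => ?_
    have h1 := line_convex hU (v := v) (m := ⟪v, T v⟫)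
      (fun x => by rw [quad_form]; exact (hUV x v).2) x
    refine (h1.add (affine_convex (-q x) (-⟪x, T v⟫))).congr fun t _ => ?_
    simp only [Pi.add_apply, hqline]; ring
  have hqV : ConvexOn ℝ univ fun x => q x - V x := by
    refine convex_of_lines fun x v => ?_
    have h1 := line_convex hV.neg (v := v) (m := -⟪v, T v⟫)
      (fun x => by
        rw [quad_form]
        have e : (fun x => -V x) = -V := rfl
        rw [e, iteratedFDeriv_neg_apply]
        simpa using (hUV x v).1) x
    refine (h1.add (affine_convex (q x) ⟪x, T v⟫)).congr fun t _ => ?_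
    simp only [Pi.add_apply, hqline]; ring
  obtain ⟨c, hc, hqc'⟩ : ∃ c : ℝ, 0 < c ∧ ∀ x, c * ‖x‖ ^ 2 ≤ q x := by
    have scal : ∀ x : EuclideanSpace ℝ (Fin d), x ≠ 0 → ‖x‖⁻¹ • x ∈ Metric.sphere (0 : EuclideanSpace ℝ (Fin d)) 1 := by
      intro x hx
      simp [norm_smul, norm_ne_zero_iff.2 hx]
    have q0 : q 0 = 0 := by simp [hq]
    rcases (Metric.sphere (0 : EuclideanSpace ℝ (Fin d)) 1).eq_empty_or_nonempty with he | hne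
    · refine ⟨1, one_pos, fun x => ?_⟩
      by_cases hx : x = 0
      · simp [hx, q0]
      · have := scal x hx; rw [he] at this; exact this.elim
    · obtain ⟨x0, hx0, hmin⟩ := (isCompact_sphere (0 : EuclideanSpace ℝ (Fin d)) 1).exists_isMinOn
        hne hqc.continuousOn
      have hx0' : x0 ≠ 0 := by
        rintro rfl; simp at hx0
      refine ⟨q x0, half_pos (hpos x0 hx0'), fun x => ?_⟩
      by_cases hx : x = 0
      · simp [hx, q0]
      · have h1 : q x0 ≤ q (‖x‖⁻¹ • x) := hmin (scal x hx)
        have hn : 0 < ‖x‖ := norm_pos_iff.2 hx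
        rw [hqsmul, inv_pow, inv_mul_eq_div, le_div_iff₀ (by positivity)] at h1
        exact h1
  obtain ⟨φ, g, hb, hmap⟩ := limit (ν := ν) (μ := μ) fun η hη =>
    approx hU.continuous hV.continuous hqc hqa hqV hUq hc hqc' hν hμ hη
  obtain ⟨h1, h2, h3⟩ := finish hb
  exact ⟨φ, h1, h2, by rw [h3]; exact lip_of_bounds hb, by rw [h3]; exact hmap⟩

end Caff

end Part9

/-- **Caffarelli's contraction theorem (generalized).** If `dμ = e^{−U} dx`,
`dν = e^{−V} dx` with `U, V` twice continuously differentiable and there is a symmetric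
positive definite matrix `A` with `∇²U ⪰ A ⪰ ∇²V` everywhere (as quadratic forms), then
`ν` is contractively optimally transported to `μ`. -/
theorem caffarelli_contraction {d : ℕ}
    (U V : Euc d → ℝ) (hU : ContDiff ℝ 2 U) (hV : ContDiff ℝ 2 V)
    (μ ν : Measure (Euc d))
    (hμ : μ = volume.withDensity fun x => ENNReal.ofReal (Real.exp (-U x)))
    (hν : ν = volume.withDensity fun x => ENNReal.ofReal (Real.exp (-V x)))
    [IsProbabilityMeasure μ] [IsProbabilityMeasure ν]
    (A : Matrix (Fin d) (Fin d) ℝ) (hA : A.PosDef)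
    (hUV : ∀ x v, iteratedFDeriv ℝ 2 V x ![v, v] ≤ ∑ i, ∑ j, A i j * v i * v j ∧
      ∑ i, ∑ j, A i j * v i * v j ≤ iteratedFDeriv ℝ 2 U x ![v, v]) :
    ContractiveOT ν μ := by
  exact Caff.main U V hU hV μ ν hμ hν A hA hUV

end
end

section
/- Let μ be a Borel probability measure on ℝ^d that is absolutely continuous with respect to Lebesgue measure and has compact support of positive Lebesgue measure. Then there exists a constant c > 0 depending only on μ and d such that for every n ∈ ℕ and every Borel probability measure ρ on ℝ^d whose support consists of at most n points, W₁(ρ, μ) ≥ c n^{−1/d}. -/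
open MeasureTheory

noncomputable section

/-- The 1-Wasserstein distance: the infimum of `∫ ‖x - y‖` over all couplings. -/
def W1 {d : ℕ} (μ ν : Measure (Euc d)) : ℝ :=
  (⨅ π ∈ {π : Measure (Euc d × Euc d) |
      IsProbabilityMeasure π ∧ π.map Prod.fst = μ ∧ π.map Prod.snd = ν},
    ∫⁻ p, (‖p.1 - p.2‖₊ : ENNReal) ∂π).toReal

/-- **Metric-entropy lower bound.** If `μ` is an absolutely continuous probability
measure on `ℝ^d` with compact support (of positive Lebesgue measure), then there is a
constant `c > 0` depending only on `μ` and `d` such that every probability measure `ρ`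
supported on at most `n` points satisfies `W₁(ρ, μ) ≥ c n^{−1/d}`. -/
theorem w1_lower_bound_finitely_supported {d : ℕ} (hd : 0 < d)
    (μ : Measure (Euc d)) [IsProbabilityMeasure μ] (hac : μ ≪ volume)
    (K : Set (Euc d)) (hK : IsCompact K) (hμK : μ Kᶜ = 0) (hvolK : 0 < volume K) :
    ∃ c > (0 : ℝ), ∀ (n : ℕ) (ρ : Measure (Euc d)), IsProbabilityMeasure ρ →
      ∀ s : Finset (Euc d), s.card ≤ n → ρ (↑s)ᶜ = 0 →
        c * (n : ℝ) ^ (-(1 : ℝ) / d) ≤ W1 ρ μ := by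
  have hδ : ∃ δ : ENNReal, 0 < δ ∧ ∀ A : Set (Euc d), volume A < δ → μ A < 1 / 2 := by
    have hfin : ∫⁻ x, μ.rnDeriv volume x ∂(volume : Measure (Euc d)) ≠ ⊤ := by
      rw [Measure.lintegral_rnDeriv hac]; simp
    obtain ⟨δ, h0, h⟩ := exists_pos_setLIntegral_lt_of_measure_lt hfin
      (ε := 1 / 2) (by simp)
    refine ⟨δ, h0, fun A hA => ?_⟩
    have := h A hA
    rwa [Measure.setLIntegral_rnDeriv hac] at this
  obtain ⟨δ, hδ0, hδ⟩ := hδ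
  obtain ⟨τ₀, hτ₀, hτδ⟩ := ENNReal.exists_nnreal_pos_mul_lt
    (a := volume (Metric.ball (0 : Euc d) 1)) (b := δ) (measure_ball_lt_top.ne) hδ0.ne'
  set τ : ℝ := min (τ₀ : ℝ) 1 with hτ
  have hτpos : 0 < τ := lt_min (by exact_mod_cast hτ₀) one_pos
  refine ⟨τ / 2, by positivity, ?_⟩
  intro n ρ hρ s hs hρs
  have hn : 0 < n := by
    rcases Nat.eq_zero_or_pos n with h | h
    · subst h
      have : s = ∅ := Finset.card_eq_zero.mp (Nat.le_zero.mp hs)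
      subst this
      simp at hρs
    · exact h
  set t : ℝ := τ * (n : ℝ) ^ (-(1 : ℝ) / d) with ht
  have hn' : (0 : ℝ) < n := by exact_mod_cast hn
  have htpos : 0 < t := by positivity
  have htd : (n : ℝ) * t ^ d = τ ^ d := by
    rw [ht, mul_pow, ← Real.rpow_natCast (_ ^ _), ← Real.rpow_mul hn'.le]
    have : (-(1 : ℝ) / d * d) = -1 := by field_simp
    rw [this, Real.rpow_neg_one]
    field_simp
  set U : Set (Euc d) := ⋃ x ∈ s, Metric.ball x t with hU
  have hUm : MeasurableSet U := (isOpen_biUnion fun _ _ => Metric.isOpen_ball).measurableSet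
  have hUvol : volume U < δ := by
    calc volume U ≤ ∑ x ∈ s, volume (Metric.ball x t) := measure_biUnion_finset_le _ _
      _ = s.card * (ENNReal.ofReal (t ^ d) * volume (Metric.ball (0 : Euc d) 1)) := by
        rw [Finset.sum_congr rfl (fun x _ => Measure.addHaar_ball_of_pos volume x htpos)]
        simp
      _ ≤ n * (ENNReal.ofReal (t ^ d) * volume (Metric.ball (0 : Euc d) 1)) := by
        gcongr
      _ = ENNReal.ofReal (τ ^ d) * volume (Metric.ball (0 : Euc d) 1) := by
        rw [← mul_assoc, ← htd, ENNReal.ofReal_mul hn'.le, ENNReal.ofReal_natCast]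
      _ ≤ τ₀ * volume (Metric.ball (0 : Euc d) 1) := by
        gcongr
        rw [ENNReal.ofReal_le_iff_le_toReal ENNReal.coe_ne_top]
        calc τ ^ d ≤ τ := pow_le_of_le_one hτpos.le (min_le_right _ _) hd.ne'
          _ ≤ _ := min_le_left (τ₀ : ℝ) 1
      _ < δ := hτδ
  have hμU := hδ U hUvol
  have hμUc : 1 / 2 ≤ μ Uᶜ := by
    by_contra hlt
    push Not at hlt
    have h1 : μ U + μ Uᶜ = 1 := by rw [measure_add_measure_compl hUm, measure_univ]
    have h2 := ENNReal.add_lt_add hμU hlt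
    rw [h1, ENNReal.add_halves] at h2
    exact lt_irrefl _ h2
  have hlow : ENNReal.ofReal (t / 2) ≤ ⨅ π ∈ {π : Measure (Euc d × Euc d) |
      IsProbabilityMeasure π ∧ π.map Prod.fst = ρ ∧ π.map Prod.snd = μ},
    ∫⁻ p, (‖p.1 - p.2‖₊ : ENNReal) ∂π := by
    refine le_iInf₂ fun π hπ => ?_
    obtain ⟨_, h1, h2⟩ := hπ
    have hsnd : π (Prod.snd ⁻¹' Uᶜ) = μ Uᶜ := by
      rw [← h2, Measure.map_apply measurable_snd hUm.compl]
    have hfst : π (Prod.fst ⁻¹' (↑s : Set (Euc d))ᶜ) = 0 := by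
      rw [← Measure.map_apply measurable_fst s.measurableSet.compl, h1, hρs]
    have hsub : (Prod.snd ⁻¹' Uᶜ : Set (Euc d × Euc d)) ⊆
        {p | ENNReal.ofReal t ≤ (‖p.1 - p.2‖₊ : ENNReal)} ∪
          Prod.fst ⁻¹' (↑s : Set (Euc d))ᶜ := by
      rintro ⟨x, y⟩ hy
      by_cases hx : x ∈ s
      · left
        have hy' : y ∉ Metric.ball x t := fun hb => hy (Set.mem_biUnion (s := (↑s : Set (Euc d))) hx hb)
        rw [Metric.mem_ball, not_lt, dist_comm, dist_eq_norm] at hy'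
        change ENNReal.ofReal t ≤ ‖x - y‖ₑ
        rw [← ofReal_norm]
        exact ENNReal.ofReal_le_ofReal hy'
      · right
        simpa using hx
    have hle : μ Uᶜ ≤ π {p | ENNReal.ofReal t ≤ (‖p.1 - p.2‖₊ : ENNReal)} := by
      rw [← hsnd]
      refine (measure_mono hsub).trans ((measure_union_le _ _).trans ?_)
      rw [hfst, add_zero]
    calc ENNReal.ofReal (t / 2) = ENNReal.ofReal t * (1 / 2) := by
          rw [ENNReal.ofReal_div_of_pos two_pos, ENNReal.ofReal_ofNat, mul_one_div]
      _ ≤ ENNReal.ofReal t * π {p | ENNReal.ofReal t ≤ (‖p.1 - p.2‖₊ : ENNReal)} := by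
          gcongr
          exact hμUc.trans hle
      _ ≤ _ := mul_meas_ge_le_lintegral (by fun_prop) _
  have hfin : (⨅ π ∈ {π : Measure (Euc d × Euc d) |
      IsProbabilityMeasure π ∧ π.map Prod.fst = ρ ∧ π.map Prod.snd = μ},
    ∫⁻ p, (‖p.1 - p.2‖₊ : ENNReal) ∂π) ≠ ⊤ := by
    have hmem : ρ.prod μ ∈ {π : Measure (Euc d × Euc d) |
      IsProbabilityMeasure π ∧ π.map Prod.fst = ρ ∧ π.map Prod.snd = μ} := by
      refine ⟨inferInstance, ?_, ?_⟩
      · simp [Measure.map_fst_prod]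
      · simp [Measure.map_snd_prod]
    refine ne_top_of_le_ne_top ?_ (iInf₂_le (ρ.prod μ) hmem)
    obtain ⟨C, hC⟩ := hK.isBounded.exists_norm_le
    obtain ⟨D, hD⟩ := (s.finite_toSet.isBounded).exists_norm_le
    have hae : ∀ᵐ p ∂(ρ.prod μ), (‖p.1 - p.2‖₊ : ENNReal) ≤ ENNReal.ofReal (D + C) := by
      have a1 : ∀ᵐ x ∂ρ, x ∈ (↑s : Set (Euc d)) := hρs
      have a2 : ∀ᵐ y ∂μ, y ∈ K := hμK
      have b1 : ∀ᵐ p ∂(ρ.prod μ), p.1 ∈ (↑s : Set (Euc d)) :=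
        Measure.quasiMeasurePreserving_fst.ae a1
      have b2 : ∀ᵐ p ∂(ρ.prod μ), p.2 ∈ K :=
        Measure.quasiMeasurePreserving_snd.ae a2
      filter_upwards [b1, b2] with p hp1 hp2
      change ‖p.1 - p.2‖ₑ ≤ _
      rw [← ofReal_norm]
      exact ENNReal.ofReal_le_ofReal
        ((norm_sub_le _ _).trans (add_le_add (hD _ hp1) (hC _ hp2)))
    refine ne_top_of_le_ne_top ?_ (lintegral_mono_ae hae)
    simp
  have hfinal := (ENNReal.ofReal_le_iff_le_toReal hfin).mp hlow
  calc τ / 2 * (n : ℝ) ^ (-(1 : ℝ) / d) = t / 2 := by rw [ht]; ring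
    _ ≤ W1 ρ μ := hfinal

end
end

section
/- Let Σ be a symmetric positive definite real d×d matrix and let h > 0 be such that the matrix M = I_d − (h²/2) Σ⁻¹ has spectral radius strictly less than 1. Then I_d − M² is invertible, the matrix Σ∞ := h² (I_d − M²)⁻¹ satisfies Σ∞ = (I_d − (h²/4) Σ⁻¹)⁻¹ Σ, and Σ∞ ⪰ Σ in the Loewner order (i.e. Σ∞ − Σ is positive semidefinite). This shows that the Gaussian stationary distribution of the unadjusted Langevin algorithm targeting N_d(μ, Σ) with step size h is overdispersed with respect to its target. -/
open Matrix

noncomputable section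

/-- **Overdispersion of the ULA stationary distribution (Gaussian target).**
For a symmetric positive definite covariance `S` and step size `h > 0` such that
`M = I − (h²/2) S⁻¹` has spectral radius `< 1`: `I − M²` is invertible, the ULA
stationary covariance `S∞ = h² (I − M²)⁻¹` equals `(I − (h²/4) S⁻¹)⁻¹ S`, and
`S∞ ⪰ S` in the Loewner order. -/
theorem ula_stationary_covariance_overdispersed {d : ℕ}
    (S : Matrix (Fin d) (Fin d) ℝ) (hS : S.PosDef)
    (h : ℝ) (hh : 0 < h)
    (M : Matrix (Fin d) (Fin d) ℝ) (hM : M = 1 - (h ^ 2 / 2) • S⁻¹)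
    (hρ : spectralRadius ℝ M < 1) :
    IsUnit ((1 : Matrix (Fin d) (Fin d) ℝ) - M * M) ∧
    h ^ 2 • ((1 : Matrix (Fin d) (Fin d) ℝ) - M * M)⁻¹ =
      ((1 : Matrix (Fin d) (Fin d) ℝ) - (h ^ 2 / 4) • S⁻¹)⁻¹ * S ∧
    (h ^ 2 • ((1 : Matrix (Fin d) (Fin d) ℝ) - M * M)⁻¹ - S).PosSemidef := by
  set c : ℝ := h ^ 2 / 4 with hc
  have hcpos : 0 < c := by positivity
  have hh2 : h ^ 2 = 4 * c := by rw [hc]; ring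
  have hSu : IsUnit S.det := (Matrix.isUnit_iff_isUnit_det S).mp hS.isUnit
  have hPS : S⁻¹ * S = 1 := Matrix.nonsing_inv_mul S hSu
  set P := S⁻¹ with hP
  set K : Matrix (Fin d) (Fin d) ℝ := 1 - c • P with hK
  have hPH : P.IsHermitian := hS.isHermitian.inv
  have hKH : K.IsHermitian := by
    apply Matrix.IsHermitian.sub Matrix.isHermitian_one
    unfold Matrix.IsHermitian
    rw [Matrix.conjTranspose_smul, hPH.eq]
    simp
  have hMK : M = (2 : ℝ) • K - 1 := by
    rw [hM, hK, hh2, smul_sub, smul_smul, two_smul]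
    rw [show 4 * c / 2 = 2 * c by ring]
    abel
  have hKpos : K.PosDef := by
    rw [hKH.posDef_iff_eigenvalues_pos]
    intro i
    have hmem : hKH.eigenvalues i ∈ spectrum ℝ K := hKH.eigenvalues_mem_spectrum_real i
    generalize hKH.eigenvalues i = l at hmem
    have hmem2 : 2 * l - 1 ∈ spectrum ℝ M := by
      rw [spectrum.mem_iff] at hmem ⊢
      intro hu
      apply hmem
      have e : algebraMap ℝ (Matrix (Fin d) (Fin d) ℝ) (2 * l - 1) - M
          = (2 : ℝ) • (algebraMap ℝ (Matrix (Fin d) (Fin d) ℝ) l - K) := by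
        rw [hMK, Algebra.algebraMap_eq_smul_one, Algebra.algebraMap_eq_smul_one]
        module
      rw [e] at hu
      have h2 := hu.smul (Units.mk0 (2⁻¹ : ℝ) (by norm_num))
      simpa [Units.smul_def, smul_smul] using h2
    have hlt : (‖2 * l - 1‖₊ : ENNReal) < 1 :=
      lt_of_le_of_lt (le_iSup₂ (f := fun (k : ℝ) (_ : k ∈ spectrum ℝ M) => (‖k‖₊ : ENNReal))
        (2 * l - 1) hmem2) hρ
    have hlt2 : |2 * l - 1| < 1 := by
      have h3 : ‖2 * l - 1‖₊ < 1 := by exact_mod_cast hlt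
      have h4 : ‖2 * l - 1‖ < 1 := by exact_mod_cast h3
      simpa [Real.norm_eq_abs] using h4
    have := (abs_lt.mp hlt2).1
    linarith
  have hKu : IsUnit K.det := (Matrix.isUnit_iff_isUnit_det K).mp hKpos.isUnit
  have hKK : K⁻¹ * K = 1 := Matrix.nonsing_inv_mul K hKu
  have hKK' : K * K⁻¹ = 1 := Matrix.mul_nonsing_inv K hKu
  have hfac : 1 - M * M = (4 * c) • (P * K) := by
    rw [hM, hh2, hK]
    simp only [mul_sub, sub_mul, mul_one, one_mul, smul_mul_assoc, mul_smul_comm]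
    module
  have hinv : (1 - M * M) * ((4 * c)⁻¹ • (K⁻¹ * S)) = 1 := by
    rw [hfac, smul_mul_smul_comm, mul_inv_cancel₀ (by positivity), one_smul,
      Matrix.mul_assoc, ← Matrix.mul_assoc K, hKK', Matrix.one_mul, hPS]
  have hformula : h ^ 2 • (1 - M * M)⁻¹ = K⁻¹ * S := by
    rw [Matrix.inv_eq_right_inv hinv, hh2, smul_smul, mul_inv_cancel₀ (by positivity), one_smul]
  refine ⟨?_, hformula, ?_⟩
  · exact (Matrix.isUnit_iff_isUnit_det _).mpr (Matrix.isUnit_det_of_right_inverse hinv)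
  · have e : K⁻¹ * S - S = c • K⁻¹ := by
      have h1 : S = K⁻¹ * (K * S) := by rw [← Matrix.mul_assoc, hKK, Matrix.one_mul]
      have h2 : K * S = S - c • 1 := by
        rw [hK, sub_mul, Matrix.one_mul, smul_mul_assoc, hPS]
      calc K⁻¹ * S - S = K⁻¹ * S - K⁻¹ * (K * S) := by rw [← h1]
        _ = c • K⁻¹ := by rw [h2, Matrix.mul_sub, mul_smul_comm, Matrix.mul_one]; abel
    rw [hformula, e]
    exact hKpos.inv.posSemidef.smul hcpos.le


end
end
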